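/- Let (s_{0,0}, …, s_{0,m}) = N(σ_0, …, σ_m) be a Nikishin system and let n = (n, n+1, …, n+1) ∈ ℤ₊^{m+1} for some n ∈ ℤ₊. Let Q_n be a type II polynomial with associated polynomials P_{n,k}, let x_{n,1}, …, x_{n,|n|} be the (simple) zeros of Q_n, all lying in the interior of Co(supp σ_0), and set λ_{n,k,i} := P_{n,k}(x_{n,i})/Q_n'(x_{n,i}). Then for every k = 0, …, m and every i = 1, …, |n| the number λ_{n,k,i} is nonzero and has the same sign as the measure s_{0,k} (i.e. sign(λ_{n,k,i}) = sign(s_{0,k}), where sign(s_{0,k}) is the constant sign of s_{0,k}). -/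

import Mathlib

open MeasureTheory Set Polynomial Filter

noncomputable section

/-- A signed Borel measure on `ℝ`, represented by a pair of (nonnegative) measures
(a "positive part" and a "negative part"). -/
structure SignedM where
  pos : MeasureTheory.Measure ℝ
  neg : MeasureTheory.Measure ℝ

namespace SignedM

/-- Integral of a complex-valued function against a signed measure. -/
def cintegral (s : SignedM) (f : ℝ → ℂ) : ℂ :=
  (∫ x, f x ∂s.pos) - ∫ x, f x ∂s.neg

/-- Integral of a real-valued function against a signed measure. -/
def rintegral (s : SignedM) (f : ℝ → ℝ) : ℝ :=
  (∫ x, f x ∂s.pos) - ∫ x, f x ∂s.neg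

/-- The Cauchy transform `ŝ(z) = ∫ ds(x)/(z - x)` at a complex point. -/
def cauchy (s : SignedM) (z : ℂ) : ℂ :=
  s.cintegral fun x => (z - (x : ℂ))⁻¹

/-- The Cauchy transform at a real point (real-valued). -/
def cauchyR (s : SignedM) (x : ℝ) : ℝ :=
  s.rintegral fun t => (x - t)⁻¹

/-- The total variation `|s|` (for the constant-sign representation used here). -/
def mass (s : SignedM) : ℝ :=
  (s.pos Set.univ).toReal + (s.neg Set.univ).toReal

/-- The (topological) support of a nonnegative measure. -/
def msupport (μ : MeasureTheory.Measure ℝ) : Set ℝ :=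
  {x | ∀ U : Set ℝ, IsOpen U → x ∈ U → μ U ≠ 0}

/-- The support of a signed measure. -/
def supp (s : SignedM) : Set ℝ := msupport s.pos ∪ msupport s.neg

/-- The signed measure `g·s` with (real, possibly sign-changing) density `g` w.r.t. `s`. -/
def withDensityR (s : SignedM) (g : ℝ → ℝ) : SignedM where
  pos := s.pos.withDensity (fun x => ENNReal.ofReal (g x)) +
    s.neg.withDensity (fun x => ENNReal.ofReal (-g x))
  neg := s.pos.withDensity (fun x => ENNReal.ofReal (-g x)) +
    s.neg.withDensity (fun x => ENNReal.ofReal (g x))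

/-- The product `⟨a, b⟩`: the measure with density `b̂` with respect to `a`. -/
def nik (a b : SignedM) : SignedM := a.withDensityR b.cauchyR

end SignedM

/-- `s ∈ M(Δ)`: a finite Borel measure with constant sign, whose support is compact and
consists of infinitely many points, `Δ` being the smallest closed interval containing it. -/
structure IsM (s : SignedM) (Δ : Set ℝ) : Prop where
  posFinite : MeasureTheory.IsFiniteMeasure s.pos
  negFinite : MeasureTheory.IsFiniteMeasure s.neg
  constSign : s.pos = 0 ∨ s.neg = 0
  compactSupp : IsCompact s.supp
  infiniteSupp : s.supp.Infinite
  hullEq : Δ = Set.Icc (sInf s.supp) (sSup s.supp)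

/-- A set of reals, viewed inside `ℂ`. -/
def cSet (Δ : Set ℝ) : Set ℂ := (fun x : ℝ => (x : ℂ)) '' Δ

/-- `τ` is the inverse measure of `s`: `1/ŝ(z) = z/|s| + b + τ̂(z)` on `ℂ ∖ Δ`. -/
def IsInverse (s τ : SignedM) (Δ : Set ℝ) : Prop :=
  ∃ b : ℝ, ∀ z : ℂ, z ∉ cSet Δ →
    (s.cauchy z)⁻¹ = z / (s.mass : ℂ) + (b : ℂ) + τ.cauchy z

/-- The iterated products `s_{j,k} = ⟨σ_j, σ_{j+1}, …, σ_k⟩` of a Nikishin system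
(`s_{j,k} = σ_j` when `j ≥ k`). -/
def nikSys (σ : ℕ → SignedM) : ℕ → ℕ → SignedM
  | j, k => if h : j < k then (σ j).nik (nikSys σ (j + 1) k) else σ j
  termination_by j k => k - j
  decreasing_by omega

/-- `Q` is a type II polynomial for the Nikishin system `N(σ₀, …, σ_m)` and the
multi-index `n`, with associated polynomials `P k`:  `Q ≠ 0`, `deg Q ≤ |n|` and
`Q·ŝ_{0,k} − P_k = O(1/z^{n_k+1})` as `z → ∞` for every `k ≤ m`. -/
def IsTypeII (σ : ℕ → SignedM) (m : ℕ) (n : ℕ → ℕ) (Q : Polynomial ℝ)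
    (P : ℕ → Polynomial ℝ) : Prop :=
  Q ≠ 0 ∧ Q.degree ≤ ((∑ j ∈ Finset.range (m + 1), n j : ℕ) : WithBot ℕ) ∧
  ∀ k ≤ m, ∃ C R : ℝ, ∀ z : ℂ, R ≤ ‖z‖ →
    ‖aeval z Q * (nikSys σ 0 k).cauchy z - aeval z (P k)‖ ≤ C / ‖z‖ ^ (n k + 1)

/-- `μ` is a finite measure carried by `[a, b]` and by no finite set. -/
structure Good (μ : Measure ℝ) (a b : ℝ) : Prop where
  finite : IsFiniteMeasure μ
  conc : μ (Icc a b)ᶜ = 0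
  infinite : ∀ S : Finset ℝ, μ (↑S : Set ℝ)ᶜ ≠ 0

/-- `g` is continuous and zero-free on `[a, b]`. -/
def NZ (g : ℝ → ℝ) (a b : ℝ) : Prop :=
  ContinuousOn g (Icc a b) ∧ ∀ x ∈ Icc a b, g x ≠ 0

/-- The Cauchy transform of `φ dμ` at a real point. -/
def cau (μ : Measure ℝ) (φ : ℝ → ℝ) (z : ℝ) : ℝ := ∫ t, φ t / (z - t) ∂μ

theorem NZ.sign {g : ℝ → ℝ} {a b : ℝ} (h : NZ g a b) :
    (∀ x ∈ Icc a b, 0 < g x) ∨ ∀ x ∈ Icc a b, g x < 0 := by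
  by_contra! hc
  obtain ⟨⟨x, hx, hgx⟩, y, hy, hgy⟩ := hc
  obtain ⟨z, hz, h0⟩ := isPreconnected_Icc.intermediate_value hx hy h.1 ⟨hgx, hgy⟩
  exact h.2 z hz h0

theorem NZ.mul {f g : ℝ → ℝ} {a b : ℝ} (hf : NZ f a b) (hg : NZ g a b) :
    NZ (fun x => f x * g x) a b :=
  ⟨hf.1.mul hg.1, fun x hx => mul_ne_zero (hf.2 x hx) (hg.2 x hx)⟩

theorem NZ.neg {f : ℝ → ℝ} {a b : ℝ} (hf : NZ f a b) : NZ (fun x => -f x) a b :=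
  ⟨hf.1.neg, fun x hx => neg_ne_zero.2 (hf.2 x hx)⟩

theorem NZ.const_mul {f : ℝ → ℝ} {a b c : ℝ} (hc : c ≠ 0) (hf : NZ f a b) :
    NZ (fun x => c * f x) a b :=
  ⟨continuousOn_const.mul hf.1, fun x hx => mul_ne_zero hc (hf.2 x hx)⟩

theorem NZ.const {a b c : ℝ} (hc : c ≠ 0) : NZ (fun _ => c) a b :=
  ⟨continuousOn_const, fun _ _ => hc⟩

theorem NZ.abs_eq {g : ℝ → ℝ} {a b : ℝ} (h : NZ g a b) :
    ∃ ε : ℝ, ε ≠ 0 ∧ ∀ x ∈ Icc a b, g x = ε * |g x| := by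
  rcases h.sign with h | h
  · exact ⟨1, one_ne_zero, fun x hx => by rw [abs_of_pos (h x hx), one_mul]⟩
  · exact ⟨-1, by norm_num, fun x hx => by rw [abs_of_neg (h x hx)]; ring⟩

theorem sub_ne_zero_of_notMem {a b z t : ℝ} (hz : z ∉ Icc a b) (ht : t ∈ Icc a b) : z - t ≠ 0 :=
  fun h => hz (by rwa [sub_eq_zero.1 h])

theorem continuousOn_div_sub {φ : ℝ → ℝ} {a b z : ℝ} (hφ : ContinuousOn φ (Icc a b))
    (hz : z ∉ Icc a b) : ContinuousOn (fun t => φ t / (z - t)) (Icc a b) :=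
  hφ.div (by fun_prop) fun _ ht => sub_ne_zero_of_notMem hz ht

namespace Good

variable {μ : Measure ℝ} {a b : ℝ}

theorem ae_mem (h : Good μ a b) : ∀ᵐ t ∂μ, t ∈ Icc a b := h.conc

theorem restrict (h : Good μ a b) : μ.restrict (Icc a b) = μ :=
  Measure.restrict_eq_self_of_ae_mem h.ae_mem

theorem integrable (h : Good μ a b) {g : ℝ → ℝ} (hg : ContinuousOn g (Icc a b)) :
    Integrable g μ := by
  have := h.finite
  rw [← h.restrict]
  exact hg.integrableOn_compact isCompact_Icc

theorem integral_congr (h : Good μ a b) {f g : ℝ → ℝ} (hfg : ∀ t ∈ Icc a b, f t = g t) :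
    ∫ t, f t ∂μ = ∫ t, g t ∂μ :=
  integral_congr_ae (h.ae_mem.mono hfg)

theorem integral_pos (h : Good μ a b) {g : ℝ → ℝ} (hg : ContinuousOn g (Icc a b))
    (h0 : ∀ t ∈ Icc a b, 0 ≤ g t) (S : Finset ℝ) (hS : ∀ t ∈ Icc a b, g t = 0 → t ∈ S) :
    0 < ∫ t, g t ∂μ := by
  have hnn : 0 ≤ᵐ[μ] g := h.ae_mem.mono h0
  refine lt_of_le_of_ne (integral_nonneg_of_ae hnn) fun h1 => ?_
  have h2 := (integral_eq_zero_iff_of_nonneg_ae hnn (h.integrable hg)).1 h1.symm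
  refine h.infinite S ?_
  have : ∀ᵐ t ∂μ, t ∈ (S : Set ℝ) := by
    filter_upwards [h2, h.ae_mem] with t ht hm using hS t hm ht
  exact this

theorem integral_ne_zero (h : Good μ a b) {g : ℝ → ℝ} (hg : NZ g a b) : ∫ t, g t ∂μ ≠ 0 := by
  rcases hg.sign with hs | hs
  · exact (h.integral_pos hg.1 (fun t ht => (hs t ht).le) ∅
      fun t ht h0 => absurd h0 (hg.2 t ht)).ne'
  · have := h.integral_pos hg.neg.1 (fun t ht => (neg_pos.2 (hs t ht)).le) ∅
      fun t ht h0 => absurd h0 (hg.neg.2 t ht)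
    rw [integral_neg] at this
    linarith

theorem cau_congr (h : Good μ a b) {φ ψ : ℝ → ℝ} (hφ : ∀ t ∈ Icc a b, φ t = ψ t) (z : ℝ) :
    cau μ φ z = cau μ ψ z :=
  h.integral_congr fun t ht => by rw [hφ t ht]

theorem cau_ne_zero (h : Good μ a b) {φ : ℝ → ℝ} (hφ : NZ φ a b) {z : ℝ} (hz : z ∉ Icc a b) :
    cau μ φ z ≠ 0 :=
  h.integral_ne_zero ⟨continuousOn_div_sub hφ.1 hz,
    fun t ht => div_ne_zero (hφ.2 t ht) (sub_ne_zero_of_notMem hz ht)⟩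

theorem integrable_cau (h : Good μ a b) {φ : ℝ → ℝ} (hφ : ContinuousOn φ (Icc a b)) {z : ℝ}
    (hz : z ∉ Icc a b) : Integrable (fun t => φ t / (z - t)) μ :=
  h.integrable (continuousOn_div_sub hφ hz)

theorem cau_add (h : Good μ a b) {φ ψ : ℝ → ℝ} (hφ : ContinuousOn φ (Icc a b))
    (hψ : ContinuousOn ψ (Icc a b)) {z : ℝ} (hz : z ∉ Icc a b) :
    cau μ (fun t => φ t + ψ t) z = cau μ φ z + cau μ ψ z := by
  unfold cau
  rw [← integral_add (h.integrable_cau hφ hz) (h.integrable_cau hψ hz)]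
  simp only [add_div]

theorem cau_sub (h : Good μ a b) {φ ψ : ℝ → ℝ} (hφ : ContinuousOn φ (Icc a b))
    (hψ : ContinuousOn ψ (Icc a b)) {z : ℝ} (hz : z ∉ Icc a b) :
    cau μ (fun t => φ t - ψ t) z = cau μ φ z - cau μ ψ z := by
  unfold cau
  rw [← integral_sub (h.integrable_cau hφ hz) (h.integrable_cau hψ hz)]
  simp only [sub_div]

theorem continuousOn_cau (h : Good μ a b) {φ : ℝ → ℝ} (hφ : ContinuousOn φ (Icc a b)) :
    ContinuousOn (cau μ φ) (Icc a b)ᶜ := by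
  intro z hz
  refine ContinuousAt.continuousWithinAt ?_
  obtain ⟨δ, hδ, hball⟩ := Metric.isOpen_iff.1 (isClosed_Icc (a := a) (b := b)).isOpen_compl z hz
  have hδ2 : 0 < δ / 2 := by positivity
  have key : ∀ y ∈ Metric.ball z (δ / 2), ∀ t ∈ Icc a b, δ / 2 ≤ |y - t| := by
    intro y hy t ht
    by_contra! hc
    refine (show t ∈ (Icc a b)ᶜ from hball ?_) ht
    rw [Metric.mem_ball, Real.dist_eq] at hy ⊢
    have : |t - z| ≤ |y - t| + |y - z| := by
      have := abs_sub_le t y z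
      rwa [abs_sub_comm t y] at this
    linarith
  refine continuousAt_of_dominated (bound := fun t => |φ t| / (δ / 2)) ?_ ?_ ?_ ?_
  · filter_upwards [Metric.ball_mem_nhds z hδ2] with y hy
    refine (h.integrable_cau hφ fun hy' => ?_).1
    have := key y hy y hy'
    simp at this
    linarith
  · filter_upwards [Metric.ball_mem_nhds z hδ2] with y hy
    filter_upwards [h.ae_mem] with t ht
    rw [Real.norm_eq_abs, abs_div]
    exact div_le_div_of_nonneg_left (abs_nonneg _) hδ2 (key y hy t ht)
  · exact h.integrable (by fun_prop)
  · filter_upwards [h.ae_mem] with t ht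
    exact continuousAt_const.div (by fun_prop) (sub_ne_zero_of_notMem hz ht)

theorem continuousOn_cau_Icc (h : Good μ a b) {φ : ℝ → ℝ} (hφ : ContinuousOn φ (Icc a b))
    {c d : ℝ} (hd : Disjoint (Icc c d) (Icc a b)) : ContinuousOn (cau μ φ) (Icc c d) :=
  (h.continuousOn_cau hφ).mono hd.subset_compl_right

theorem nz_cau (h : Good μ a b) {φ : ℝ → ℝ} (hφ : NZ φ a b)
    {c d : ℝ} (hd : Disjoint (Icc c d) (Icc a b)) : NZ (cau μ φ) c d :=
  ⟨h.continuousOn_cau_Icc hφ.1 hd, fun _ hx => h.cau_ne_zero hφ (hd.subset_compl_right hx)⟩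

/-- A continuous density with finitely many zeros preserves `Good`. -/
theorem withDensity_of_zeros (h : Good μ a b) {g : ℝ → ℝ} (hg : ContinuousOn g (Icc a b))
    {S₀ : Finset ℝ} (hz : ∀ t ∈ Icc a b, g t = 0 → t ∈ S₀) :
    Good (μ.withDensity fun t => ENNReal.ofReal |g t|) a b := by
  have hi := h.integrable hg.abs
  refine ⟨isFiniteMeasure_withDensity_ofReal hi.2, withDensity_absolutelyContinuous _ _ h.conc,
    fun S hS => h.infinite (S ∪ S₀) ?_⟩
  rw [withDensity_apply_eq_zero' hi.1.aemeasurable.ennreal_ofReal] at hS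
  refine measure_mono_null (t := ({x | ENNReal.ofReal |g x| ≠ 0} ∩ (↑S)ᶜ) ∪ (Icc a b)ᶜ) ?_
    (measure_union_null hS h.conc)
  intro t ht
  simp only [Finset.coe_union, mem_compl_iff, mem_union, Finset.mem_coe, not_or] at ht
  by_cases hm : t ∈ Icc a b
  · exact Or.inl ⟨by simpa using fun h0 => ht.2 (hz t hm h0), ht.1⟩
  · exact Or.inr hm

theorem withDensity (h : Good μ a b) {g : ℝ → ℝ} (hg : NZ g a b) :
    Good (μ.withDensity fun t => ENNReal.ofReal |g t|) a b :=
  h.withDensity_of_zeros (S₀ := ∅) hg.1 fun t ht h0 => absurd h0 (hg.2 t ht)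

theorem integral_withDensity (h : Good μ a b) {g : ℝ → ℝ} (hg : ContinuousOn g (Icc a b))
    (F : ℝ → ℝ) :
    ∫ t, F t ∂(μ.withDensity fun t => ENNReal.ofReal |g t|) = ∫ t, |g t| * F t ∂μ := by
  rw [integral_withDensity_eq_integral_toReal_smul₀
    (h.integrable hg.abs).1.aemeasurable.ennreal_ofReal (by simp)]
  simp

end Good

theorem exists_sign_prod (a b : ℝ) (Z : Finset ℝ) :
    ∀ G : ℝ → ℝ, (∀ z ∈ Z, G z = 0) →
      (∀ x ∈ Icc a b, ∀ y ∈ Icc a b, x < y → G x * G y < 0 → ∃ z ∈ Z, z ∈ Icc x y) →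
      ∃ Y ⊆ Z, ∃ ε : ℝ, ε ≠ 0 ∧ ∀ x ∈ Icc a b, 0 ≤ ε * (G x * ∏ y ∈ Y, (x - y)) := by
  induction Z using Finset.induction_on with
  | empty =>
    intro G _ h
    have h' : ∀ x ∈ Icc a b, ∀ y ∈ Icc a b, 0 ≤ G x * G y := by
      intro x hx y hy
      by_contra! hc
      rcases lt_trichotomy x y with hxy | hxy | hxy
      · simpa using h x hx y hy hxy hc
      · rw [hxy] at hc
        nlinarith [mul_self_nonneg (G y)]
      · simpa using h y hy x hx hxy (by rwa [mul_comm])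
    by_cases hp : ∃ x ∈ Icc a b, G x ≠ 0
    · obtain ⟨x, hx, hGx⟩ := hp
      exact ⟨∅, subset_rfl, G x, hGx, fun y hy => by simpa using h' x hx y hy⟩
    · push Not at hp
      exact ⟨∅, subset_rfl, 1, one_ne_zero, fun y hy => by simp [hp y hy]⟩
  | insert z Z hz ih =>
    intro G h0 h
    by_cases hs : ∃ x ∈ Icc a b, ∃ y ∈ Icc a b, x < y ∧ G x * G y < 0 ∧ ∀ w ∈ Z, w ∉ Icc x y
    · obtain ⟨x, hx, y, hy, hxy, hG, hw⟩ := hs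
      have hGz : G z = 0 := h0 z (Finset.mem_insert_self _ _)
      have hmem : ∀ {x y : ℝ}, x ∈ Icc a b → y ∈ Icc a b → x < y → G x * G y < 0 →
          (∀ w ∈ Z, w ∉ Icc x y) → x < z ∧ z < y := by
        intro x y hx hy hxy hG hw
        obtain ⟨v, hv, hvm⟩ := h x hx y hy hxy hG
        rcases Finset.mem_insert.1 hv with rfl | hv
        · refine ⟨lt_of_le_of_ne hvm.1 ?_, lt_of_le_of_ne hvm.2 ?_⟩
          · rintro rfl; simp [hGz] at hG
          · rintro rfl; simp [hGz] at hG
        · exact absurd hvm (hw v hv)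
      have hz' := hmem hx hy hxy hG hw
      have hnn : ∀ u ∈ Icc a b, ∀ v ∈ Icc a b, (∀ w ∈ Z, w ∉ Icc u v) → (∀ w ∈ Z, w ∉ Icc v u) →
          ((u < z ∧ v < z) ∨ (z < u ∧ z < v)) → 0 ≤ G u * G v := by
        intro u hu v hv h1 h2 h3
        by_contra! hc
        rcases lt_trichotomy u v with huv | huv | huv
        · have := hmem hu hv huv hc h1
          rcases h3 with h3 | h3 <;> linarith [h3.1, h3.2, this.1, this.2]
        · rw [huv] at hc
          nlinarith [mul_self_nonneg (G v)]
        · have := hmem hv hu huv (by rwa [mul_comm]) h2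
          rcases h3 with h3 | h3 <;> linarith [h3.1, h3.2, this.1, this.2]
      obtain ⟨Y, hY, ε, hε, hfin⟩ := ih (fun t => (t - z) * G t)
        (fun w hw => by simp [h0 w (Finset.mem_insert_of_mem hw)]) (by
          intro x' hx' y' hy' hxy' hG'
          by_contra! hw'
          have hx'z : x' ≠ z := by rintro rfl; simp at hG'
          have hy'z : y' ≠ z := by rintro rfl; simp at hG'
          have e : (x' - z) * G x' * ((y' - z) * G y') = (x' - z) * (y' - z) * (G x' * G y') := by
            ring
          simp only [e] at hG'
          rcases lt_or_gt_of_ne hx'z with h1 | h1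
          · rcases lt_or_gt_of_ne hy'z with h2 | h2
            · have h3 : 0 < (x' - z) * (y' - z) := mul_pos_of_neg_of_neg (by linarith) (by linarith)
              have := hmem hx' hy' hxy' (by
                by_contra! hc
                exact absurd hG' (not_lt.2 (mul_nonneg h3.le hc))) hw'
              linarith [this.2]
            · have h3 : (x' - z) * (y' - z) < 0 := mul_neg_of_neg_of_pos (by linarith) (by linarith)
              have h4 : 0 < G x' * G y' := by
                by_contra! hc
                exact absurd hG' (not_lt.2 (mul_nonneg_of_nonpos_of_nonpos h3.le hc))
              have h5 := hnn x hx x' hx'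
                (fun w hwZ hm => hw w hwZ ⟨hm.1, by linarith [hm.2, hz'.2]⟩)
                (fun w hwZ hm => hw' w hwZ ⟨hm.1, by linarith [hm.2, hz'.1]⟩)
                (Or.inl ⟨hz'.1, h1⟩)
              have h6 := hnn y hy y' hy'
                (fun w hwZ hm => hw' w hwZ ⟨by linarith [hm.1, hz'.2], hm.2⟩)
                (fun w hwZ hm => hw w hwZ ⟨by linarith [hm.1, hz'.1], hm.2⟩)
                (Or.inr ⟨hz'.2, h2⟩)
              have h7 : (G x * G y) * (G x' * G y') < 0 := mul_neg_of_neg_of_pos hG h4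
              have h8 := mul_nonneg h5 h6
              nlinarith
          · have h2 : z < y' := h1.trans hxy'
            have h3 : 0 < (x' - z) * (y' - z) := mul_pos (by linarith) (by linarith)
            have := hmem hx' hy' hxy' (by
                by_contra! hc
                exact absurd hG' (not_lt.2 (mul_nonneg h3.le hc))) hw'
            linarith [this.1])
      refine ⟨insert z Y, Finset.insert_subset_insert _ hY, ε, hε, fun t ht => ?_⟩
      rw [Finset.prod_insert (fun hzY => hz (hY hzY))]
      convert hfin t ht using 2
      ring
    · push Not at hs
      obtain ⟨Y, hY, hfin⟩ := ih G (fun w hw => h0 w (Finset.mem_insert_of_mem hw)) hs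
      exact ⟨Y, hY.trans (Finset.subset_insert _ _), hfin⟩

/-- A continuous function with finitely many zeros becomes of constant sign after multiplication by
a product of linear factors at some of its zeros. -/
theorem ContinuousOn.exists_sign_prod {G : ℝ → ℝ} {a b : ℝ} (hG : ContinuousOn G (Icc a b))
    (Z : Finset ℝ) (hZ : ∀ z ∈ Z, G z = 0) (hZ' : ∀ z ∈ Icc a b, G z = 0 → z ∈ Z) :
    ∃ Y ⊆ Z, ∃ ε : ℝ, ε ≠ 0 ∧ ∀ x ∈ Icc a b, 0 ≤ ε * (G x * ∏ y ∈ Y, (x - y)) := by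
  refine _root_.exists_sign_prod a b Z G hZ fun x hx y hy hxy hneg => ?_
  have hsub : Icc x y ⊆ Icc a b := Icc_subset_Icc hx.1 hy.2
  have : (0 : ℝ) ∈ uIcc (G x) (G y) := by
    rcases mul_neg_iff.1 hneg with h | h
    · exact ⟨by simp [h.2.le], by simp [h.1.le]⟩
    · exact ⟨by simp [h.1.le], by simp [h.2.le]⟩
  have hu := intermediate_value_uIcc (a := x) (b := y) (f := G) (by
    rw [uIcc_of_le hxy.le]; exact hG.mono hsub) this
  obtain ⟨z, hz, hz0⟩ := hu
  rw [uIcc_of_le hxy.le] at hz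
  exact ⟨z, hZ' z (hsub hz) hz0, hz⟩

theorem exists_finset_zeros {G : ℝ → ℝ} {I : Set ℝ} {r : ℕ}
    (hr : ∀ S : Finset ℝ, (∀ s ∈ S, s ∈ I) → (∀ s ∈ S, G s = 0) → S.card < r) :
    ∃ Z : Finset ℝ, ∀ z, z ∈ Z ↔ z ∈ I ∧ G z = 0 := by
  have hfin : {z | z ∈ I ∧ G z = 0}.Finite := by
    by_contra hinf
    obtain ⟨t, ht, hcard⟩ := Set.Infinite.exists_subset_card_eq hinf r
    exact absurd (hr t (fun s hs => (ht hs).1) fun s hs => (ht hs).2) (by lia)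
  exact ⟨hfin.toFinset, by simp⟩

namespace Good

variable {μ : Measure ℝ} {a b : ℝ}

theorem mul_cau (h : Good μ a b) {φ : ℝ → ℝ} (hφ : ContinuousOn φ (Icc a b)) {z : ℝ}
    (hz : z ∉ Icc a b) : z * cau μ φ z = ∫ t, φ t ∂μ + cau μ (fun t => t * φ t) z := by
  unfold cau
  rw [← integral_add (h.integrable hφ) (h.integrable_cau (by fun_prop) hz), ← integral_const_mul]
  refine h.integral_congr fun t ht => ?_
  have := sub_ne_zero_of_notMem hz ht
  field_simp
  ring

theorem cau_const_mul (c : ℝ) (φ : ℝ → ℝ) (z : ℝ) :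
    cau μ (fun t => c * φ t) z = c * cau μ φ z := by
  unfold cau
  rw [← integral_const_mul]
  simp only [mul_div_assoc]

/-- The product of a polynomial and a Cauchy transform is a polynomial plus a Cauchy transform. -/
theorem exists_polyPart (h : Good μ a b) (d : ℕ) : ∀ {p : ℝ[X]} (_ : p.degree < (d + 1 : ℕ))
    {φ : ℝ → ℝ} (_ : ContinuousOn φ (Icc a b)),
    ∃ q : ℝ[X], q.degree < d ∧ ∀ z ∉ Icc a b,
      p.eval z * cau μ φ z = q.eval z + cau μ (fun t => p.eval t * φ t) z := by
  induction d with
  | zero =>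
    intro p hp φ hφ
    have hp' : p = C (p.coeff 0) := eq_C_of_degree_le_zero (degree_le_of_natDegree_le (by
      rcases eq_or_ne p 0 with h0 | h0
      · simp [h0]
      · rw [degree_eq_natDegree h0] at hp
        have : p.natDegree < 0 + 1 := by exact_mod_cast hp
        lia))
    refine ⟨0, by simp, fun z hz => ?_⟩
    rw [hp']
    simp [cau_const_mul]
  | succ d ih =>
    intro p hp φ hφ
    obtain ⟨q, hq, hqz⟩ := ih (p := divX p) (by
      rcases eq_or_ne (divX p) 0 with h0 | h0
      · rw [h0, degree_zero]; exact WithBot.bot_lt_coe _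
      · have : p ≠ 0 := by rintro rfl; simp at h0
        have hlt := degree_divX_lt this
        rw [degree_eq_natDegree h0] at hlt ⊢
        rw [degree_eq_natDegree this] at hlt hp
        have h1 : p.divX.natDegree < p.natDegree := by exact_mod_cast hlt
        have h2 : p.natDegree < d + 1 + 1 := by exact_mod_cast hp
        exact_mod_cast (by lia : p.divX.natDegree < d + 1)) (φ := fun t => t * φ t) (by fun_prop)
    refine ⟨divX p * C (∫ t, φ t ∂μ) + q, ?_, fun z hz => ?_⟩
    · refine (degree_add_le _ _).trans_lt (max_lt ?_ (hq.trans (by exact_mod_cast d.lt_succ_self)))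
      refine (degree_mul_le _ _).trans_lt ((add_le_add_right degree_C_le _).trans_lt ?_)
      rw [add_zero]
      rcases eq_or_ne (divX p) 0 with h0 | h0
      · rw [h0, degree_zero]; exact WithBot.bot_lt_coe _
      · have : p ≠ 0 := by rintro rfl; simp at h0
        have hlt := degree_divX_lt this
        rw [degree_eq_natDegree h0] at hlt ⊢
        rw [degree_eq_natDegree this] at hlt hp
        have h1 : p.divX.natDegree < p.natDegree := by exact_mod_cast hlt
        have h2 : p.natDegree < d + 1 + 1 := by exact_mod_cast hp
        exact_mod_cast (by lia : p.divX.natDegree < d + 1)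
    · have e : ∀ u, p.eval u = (divX p).eval u * u + p.coeff 0 := fun u => by
        conv_lhs => rw [← divX_mul_X_add p]
        simp
      have e2 := hqz z hz
      have e3 := h.mul_cau hφ hz
      have e4 : cau μ (fun t => p.eval t * φ t) z =
          cau μ (fun t => (divX p).eval t * (t * φ t)) z + p.coeff 0 * cau μ φ z := by
        rw [← cau_const_mul, ← h.cau_add (by fun_prop) (by fun_prop) hz]
        refine h.cau_congr (fun t _ => ?_) z
        rw [e t]; ring
      rw [e4, e z]
      simp only [eval_add, eval_mul, eval_C]
      linear_combination (divX p).eval z * e3 + e2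

/-- The zeros of a polynomial plus a Cauchy transform are controlled by those of the density. -/
theorem card_zeros_lt (h : Good μ a b) {c e : ℝ} (hd : Disjoint (Icc c e) (Icc a b)) {G : ℝ → ℝ}
    (hG : ContinuousOn G (Icc a b)) {r d : ℕ}
    (hr : ∀ S : Finset ℝ, (∀ s ∈ S, s ∈ Icc a b) → (∀ s ∈ S, G s = 0) → S.card < r)
    {P : ℝ[X]} (hP : P.degree < (d + 1 : ℕ)) {Z : Finset ℝ} (hZ : ∀ z ∈ Z, z ∈ Icc c e)
    (h0 : ∀ z ∈ Z, P.eval z + cau μ G z = 0) : Z.card < d + 1 + r := by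
  by_contra! hcard
  obtain ⟨V, hV⟩ := exists_finset_zeros hr
  have hVr : V.card < r := hr V (fun s hs => ((hV s).1 hs).1) fun s hs => ((hV s).1 hs).2
  obtain ⟨Y, hY, ε, hε, hsign⟩ := hG.exists_sign_prod V (fun z hz => ((hV z).1 hz).2)
    fun z hz hz0 => (hV z).2 ⟨hz, hz0⟩
  have hYr : Y.card < r := (Finset.card_le_card hY).trans_lt hVr
  set q : ℝ[X] := Lagrange.nodal Y id with hq
  have hqdeg : q.degree = Y.card := Lagrange.degree_nodal
  have hqe : ∀ t, q.eval t = ∏ y ∈ Y, (t - y) := fun t => by simp [hq, Lagrange.eval_nodal]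
  set w : ℝ[X] := Lagrange.nodal Z id with hw
  have hwe : ∀ t, w.eval t = ∏ y ∈ Z, (t - y) := fun t => by simp [hw, Lagrange.eval_nodal]
  have hinj : Set.InjOn (id : ℝ → ℝ) Z := Set.injOn_id _
  have hnotZ : ∀ t ∈ Icc a b, t ∉ Z := fun t ht hz => (hd.subset_compl_right (hZ t hz)) ht
  have hwNZ : NZ (fun t => w.eval t) a b := by
    refine ⟨by fun_prop, fun t ht => ?_⟩
    simp only [hwe, Finset.prod_ne_zero_iff]
    exact fun z hz h => hnotZ t ht (by rwa [sub_eq_zero.1 h])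
  obtain ⟨η, hη, hws⟩ := hwNZ.abs_eq
  have hfrac : ∀ t ∈ Icc a b, q.eval t / w.eval t * G t =
      ∑ z ∈ Z, -(Lagrange.nodalWeight Z id z * q.eval z) * (G t / (z - t)) := by
    intro t ht
    have h1 : q = Lagrange.interpolate Z id fun z => q.eval (id z) :=
      Lagrange.eq_interpolate hinj (by
        rw [hqdeg]; exact_mod_cast (by lia : Y.card < Z.card))
    have h2 := Lagrange.eval_interpolate_not_at_node (s := Z) (v := (id : ℝ → ℝ)) (x := t)
      (fun z => q.eval (id z)) (fun z hz h => hnotZ t ht (by rw [h]; exact hz))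
    rw [← h1] at h2
    rw [h2, mul_div_cancel_left₀ _ (hwNZ.2 t ht), Finset.sum_mul]
    refine Finset.sum_congr rfl fun z hz => ?_
    have h3 : t - z ≠ 0 := fun h => hnotZ t ht (by rwa [sub_eq_zero.1 h])
    have h4 : z - t ≠ 0 := fun h => h3 (by linarith)
    simp only [id]
    field_simp
    ring
  have hzero : ∫ t, q.eval t / w.eval t * G t ∂μ = 0 := by
    rw [h.integral_congr hfrac, integral_finsetSum _ fun z hz =>
      (h.integrable_cau hG (hd.subset_compl_right (hZ z hz))).const_mul _]
    have h5 : ∀ z ∈ Z, ∫ t, -(Lagrange.nodalWeight Z id z * q.eval z) * (G t / (z - t)) ∂μ =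
        (q * P).eval (id z) / ∏ y ∈ Z.erase z, (id z - id y) := by
      intro z hz
      rw [integral_const_mul]
      have : cau μ G z = - P.eval z := by linarith [h0 z hz]
      unfold cau at this
      rw [this, Lagrange.nodalWeight, Finset.prod_inv_distrib, eval_mul, div_eq_mul_inv]
      simp only [id]
      ring
    rw [Finset.sum_congr rfl h5, ← Lagrange.coeff_eq_sum hinj]
    · refine coeff_eq_zero_of_degree_lt ?_
      rw [degree_mul, hqdeg]
      rcases eq_or_ne P 0 with h6 | h6
      · simp [h6]
      · rw [degree_eq_natDegree h6] at hP ⊢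
        have : P.natDegree < d + 1 := by exact_mod_cast hP
        exact_mod_cast (by lia : Y.card + P.natDegree < Z.card - 1)
    · rw [degree_mul, hqdeg]
      rcases eq_or_ne P 0 with h6 | h6
      · simp [h6]
      · rw [degree_eq_natDegree h6] at hP ⊢
        have : P.natDegree < d + 1 := by exact_mod_cast hP
        exact_mod_cast (by lia : Y.card + P.natDegree < Z.card)
  have hpos := h.integral_pos (g := fun t => ε * η * (q.eval t / w.eval t * G t)) ?_ ?_ V ?_
  · rw [integral_const_mul, hzero, mul_zero] at hpos
    exact lt_irrefl _ hpos
  · exact continuousOn_const.mul ((ContinuousOn.div (by fun_prop) (by fun_prop) hwNZ.2).mul hG)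
  · intro t ht
    have h6 := hsign t ht
    rw [← hqe] at h6
    have h7 : 0 < |w.eval t| := abs_pos.2 (hwNZ.2 t ht)
    have h8 : ε * η * (q.eval t / w.eval t * G t) = ε * (G t * q.eval t) / |w.eval t| := by
      have h9 := hws t ht
      have h10 := hwNZ.2 t ht
      simp only at h9 h10
      generalize |w.eval t| = v at *
      rw [h9] at h10 ⊢
      field_simp
    rw [h8]
    positivity
  · intro t ht h6
    rcases mul_eq_zero.1 h6 with h7 | h7
    · exact absurd h7 (mul_ne_zero hε hη)
    · rcases mul_eq_zero.1 h7 with h8 | h8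
      · rcases div_eq_zero_iff.1 h8 with h9 | h9
        · rw [hqe, Finset.prod_eq_zero_iff] at h9
          obtain ⟨y, hy, hty⟩ := h9
          rw [sub_eq_zero.1 hty]
          exact hY hy
        · exact absurd h9 (hwNZ.2 t ht)
      · exact (hV t).2 ⟨ht, h8⟩

end Good

/-- The linear form `∑ pᵢ fᵢ` over a list of indices. -/
def lform (p : ℕ → ℝ[X]) (f : ℕ → ℝ → ℝ) (l : List ℕ) (x : ℝ) : ℝ :=
  (l.map fun i => (p i).eval x * f i x).sum

@[simp] theorem lform_nil (p : ℕ → ℝ[X]) (f : ℕ → ℝ → ℝ) (x : ℝ) : lform p f [] x = 0 := rfl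

@[simp] theorem lform_cons (p : ℕ → ℝ[X]) (f : ℕ → ℝ → ℝ) (i : ℕ) (l : List ℕ) (x : ℝ) :
    lform p f (i :: l) x = (p i).eval x * f i x + lform p f l x := by
  simp [lform]

theorem lform_eq_zero {p : ℕ → ℝ[X]} {l : List ℕ} (h : ∀ i ∈ l, p i = 0) (f : ℕ → ℝ → ℝ)
    (x : ℝ) : lform p f l x = 0 := by
  induction l with
  | nil => rfl
  | cons i l ih =>
    rw [lform_cons, h i (by simp), ih fun j hj => h j (by simp [hj])]
    simp

theorem lform_congr {p : ℕ → ℝ[X]} {f g : ℕ → ℝ → ℝ} {l : List ℕ} {x : ℝ}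
    (h : ∀ i ∈ l, f i x = g i x) : lform p f l x = lform p g l x := by
  induction l with
  | nil => rfl
  | cons i l ih =>
    rw [lform_cons, lform_cons, h i (by simp), ih fun j hj => h j (by simp [hj])]

theorem lform_mul_left (p : ℕ → ℝ[X]) (f : ℕ → ℝ → ℝ) (g : ℝ → ℝ) (l : List ℕ) (x : ℝ) :
    lform p (fun i x => g x * f i x) l x = g x * lform p f l x := by
  induction l with
  | nil => simp
  | cons i l ih => rw [lform_cons, lform_cons, ih]; ring

theorem lform_poly_mul_left (r : ℝ[X]) (p : ℕ → ℝ[X]) (f : ℕ → ℝ → ℝ) (l : List ℕ) (x : ℝ) :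
    lform (fun i => r * p i) f l x = r.eval x * lform p f l x := by
  induction l with
  | nil => simp
  | cons i l ih => rw [lform_cons, lform_cons, ih, eval_mul]; ring

theorem continuousOn_lform {p : ℕ → ℝ[X]} {f : ℕ → ℝ → ℝ} {l : List ℕ} {s : Set ℝ}
    (h : ∀ i ∈ l, ContinuousOn (f i) s) : ContinuousOn (lform p f l) s := by
  induction l with
  | nil => exact continuousOn_const
  | cons i l ih =>
    have h1 := h i (by simp)
    have h2 := ih fun j hj => h j (by simp [hj])
    simp only [funext (lform_cons p f i l)]
    fun_prop

theorem card_roots_lt {p : ℝ[X]} (hp : p ≠ 0) {d : ℕ} (hd : p.degree < d) {Z : Finset ℝ}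
    (hZ : ∀ z ∈ Z, p.eval z = 0) : Z.card < d := by
  have h1 : Z ⊆ p.roots.toFinset := fun z hz => by simp [hp, hZ z hz]
  have h2 := (Finset.card_le_card h1).trans (Multiset.toFinset_card_le _)
  have h3 := h2.trans p.card_roots'
  rw [degree_eq_natDegree hp] at hd
  have : p.natDegree < d := by exact_mod_cast hd
  lia

namespace Good

variable {μ : Measure ℝ} {a b : ℝ}

theorem exists_polyPart_lform (h : Good μ a b) {d : ℕ} {p : ℕ → ℝ[X]} {φ : ℕ → ℝ → ℝ} {l : List ℕ}
    (hp : ∀ i ∈ l, (p i).degree < (d + 1 : ℕ)) (hφ : ∀ i ∈ l, ContinuousOn (φ i) (Icc a b)) :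
    ∃ q : ℝ[X], q.degree < d ∧ ∀ z ∉ Icc a b,
      lform p (fun i => cau μ (φ i)) l z = q.eval z + cau μ (lform p φ l) z := by
  induction l with
  | nil => exact ⟨0, by simp, fun z hz => by simp [cau]⟩
  | cons i l ih =>
    obtain ⟨q, hq, hqz⟩ := ih (fun j hj => hp j (by simp [hj])) fun j hj => hφ j (by simp [hj])
    obtain ⟨r, hr, hrz⟩ := h.exists_polyPart d (hp i (by simp)) (hφ i (by simp))
    refine ⟨r + q, (degree_add_le _ _).trans_lt (max_lt hr hq), fun z hz => ?_⟩
    have h1 := hφ i (by simp)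
    have h2 := continuousOn_lform (p := p) fun j (hj : j ∈ l) => hφ j (by simp [hj])
    rw [lform_cons, hqz z hz, hrz z hz, funext (lform_cons p φ i l),
      h.cau_add (by fun_prop) h2 hz, eval_add]
    ring

/-- Zero count for a polynomial plus a combination of Cauchy transforms. -/
theorem card_zeros_lform_lt (h : Good μ a b) {c e : ℝ} (hd : Disjoint (Icc c e) (Icc a b))
    {r d : ℕ} {p : ℕ → ℝ[X]} {φ : ℕ → ℝ → ℝ} {l : List ℕ}
    (hp : ∀ i ∈ l, (p i).degree < (d + 1 + 1 : ℕ)) (hφ : ∀ i ∈ l, ContinuousOn (φ i) (Icc a b))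
    (hr : ∀ S : Finset ℝ, (∀ s ∈ S, s ∈ Icc a b) → (∀ s ∈ S, lform p φ l s = 0) → S.card < r)
    {P : ℝ[X]} (hP : P.degree < (d + 1 : ℕ)) {Z : Finset ℝ} (hZ : ∀ z ∈ Z, z ∈ Icc c e)
    (h0 : ∀ z ∈ Z, P.eval z + lform p (fun i => cau μ (φ i)) l z = 0) : Z.card < d + 1 + r := by
  obtain ⟨q, hq, hqz⟩ := h.exists_polyPart_lform hp hφ
  refine h.card_zeros_lt hd (continuousOn_lform hφ) hr
    ((degree_add_le _ _).trans_lt (max_lt hP hq)) hZ fun z hz => ?_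
  rw [← h0 z hz, hqz z (hd.subset_compl_right (hZ z hz)), eval_add]
  ring

end Good

/-- A chain of Cauchy-type representations of a family `f` along the pivots in the list. -/
def WChain : List ℕ → ℝ → ℝ → (ℕ → ℝ → ℝ) → Prop
  | [], a, b, f => NZ (f 0) a b
  | k :: l, a, b, f => ∃ (a₁ b₁ : ℝ) (μ : Measure ℝ) (A α : ℕ → ℝ) (φ : ℕ → ℝ → ℝ),
      Good μ a₁ b₁ ∧ Disjoint (Icc a b) (Icc a₁ b₁) ∧ NZ (f k) a b ∧
      (∀ i ∈ 0 :: l, ContinuousOn (φ i) (Icc a₁ b₁)) ∧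
      (∀ i ∈ 0 :: l, ∀ x ∈ Icc a b, f i x = f k x * (A i + α i * x + cau μ (φ i) x)) ∧
      (∀ i ∈ l, α i = 0) ∧ WChain l a₁ b₁ φ

/-- A chain as in `WChain` in which every ratio is a constant plus a Cauchy transform without zeros
off its interval, apart from the index `0`. -/
def SChain : List ℕ → ℝ → ℝ → (ℕ → ℝ → ℝ) → Prop
  | [], a, b, f => NZ (f 0) a b
  | k :: l, a, b, f => ∃ (a₁ b₁ : ℝ) (μ : Measure ℝ) (A α : ℕ → ℝ) (φ : ℕ → ℝ → ℝ),
      Good μ a₁ b₁ ∧ Disjoint (Icc a b) (Icc a₁ b₁) ∧ NZ (f k) a b ∧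
      (∀ i ∈ 0 :: l, ContinuousOn (φ i) (Icc a₁ b₁)) ∧
      (∀ i ∈ 0 :: l, ∀ x ∈ Icc a b, f i x = f k x * (A i + α i * x + cau μ (φ i) x)) ∧
      (∀ i ∈ l, α i = 0 ∧ A i ≠ 0 ∧ NZ (φ i) a₁ b₁ ∧ ∀ z ∉ Icc a₁ b₁, A i + cau μ (φ i) z ≠ 0) ∧
      SChain l a₁ b₁ φ

/-- A chain of Cauchy transforms, as provided by a Nikishin system. -/
def NChain : List ℕ → ℕ → ℝ → ℝ → (ℕ → ℝ → ℝ) → Prop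
  | [], p, a, b, f => NZ (f p) a b
  | j :: l, p, a, b, f => ∃ (a₁ b₁ : ℝ) (μ : Measure ℝ) (φ : ℕ → ℝ → ℝ),
      Good μ a₁ b₁ ∧ Disjoint (Icc a b) (Icc a₁ b₁) ∧ NZ (f p) a b ∧
      (∀ i ∈ j :: l, NZ (φ i) a₁ b₁ ∧ ∀ x ∈ Icc a b, f i x = f p x * cau μ (φ i) x) ∧
      NChain l j a₁ b₁ φ

theorem SChain.wChain : ∀ {l : List ℕ} {a b : ℝ} {f : ℕ → ℝ → ℝ}, SChain l a b f → WChain l a b f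
  | [], _, _, _, h => h
  | _ :: _, _, _, _, ⟨a', b', μ, A, α, φ, h1, h2, h3, h4, h5, h6, h7⟩ =>
    ⟨a', b', μ, A, α, φ, h1, h2, h3, h4, h5, fun i hi => (h6 i hi).1, h7.wChain⟩

theorem WChain.congr_mul {l : List ℕ} {a b : ℝ} {f F : ℕ → ℝ → ℝ} {g : ℝ → ℝ} (hg : NZ g a b)
    (hF : ∀ i ∈ 0 :: l, ∀ x ∈ Icc a b, F i x = g x * f i x) (h : WChain l a b f) :
    WChain l a b F := by
  have key : ∀ i ∈ 0 :: l, NZ (f i) a b → NZ (F i) a b := fun i hi hn =>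
    ⟨(hg.1.mul hn.1).congr (hF i hi), fun x hx => by
      rw [hF i hi x hx]; exact mul_ne_zero (hg.2 x hx) (hn.2 x hx)⟩
  cases l with
  | nil => exact key 0 (by simp) h
  | cons k l =>
    obtain ⟨a', b', μ, A, α, φ, h1, h2, h3, h4, h5, h6, h7⟩ := h
    refine ⟨a', b', μ, A, α, φ, h1, h2, key k (by simp) h3, h4, fun i hi x hx => ?_, h6, h7⟩
    rw [hF k (by simp) x hx, hF i (by simp at hi ⊢; tauto) x hx, h5 i hi x hx, mul_assoc]

theorem NChain.congr_mul {l : List ℕ} {p : ℕ} {a b : ℝ} {f F : ℕ → ℝ → ℝ} {g : ℝ → ℝ}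
    (hg : NZ g a b) (hF : ∀ i ∈ p :: l, ∀ x ∈ Icc a b, F i x = g x * f i x)
    (h : NChain l p a b f) : NChain l p a b F := by
  have key : ∀ i ∈ p :: l, NZ (f i) a b → NZ (F i) a b := fun i hi hn =>
    ⟨(hg.1.mul hn.1).congr (hF i hi), fun x hx => by
      rw [hF i hi x hx]; exact mul_ne_zero (hg.2 x hx) (hn.2 x hx)⟩
  cases l with
  | nil => exact key p (by simp) h
  | cons j l =>
    obtain ⟨a', b', μ, φ, h1, h2, h3, h4, h5⟩ := h
    refine ⟨a', b', μ, φ, h1, h2, key p (by simp) h3, fun i hi => ⟨(h4 i hi).1, fun x hx => ?_⟩, h5⟩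
    rw [hF p (by simp) x hx, hF i (List.mem_cons_of_mem _ hi) x hx, (h4 i hi).2 x hx, mul_assoc]

theorem exists_const_lform {d : ℕ} {p : ℕ → ℝ[X]} (A : ℕ → ℝ) {l : List ℕ}
    (hp : ∀ i ∈ l, (p i).degree < d) :
    ∃ q : ℝ[X], q.degree < d ∧ ∀ x, q.eval x = lform p (fun i _ => A i) l x := by
  induction l with
  | nil => exact ⟨0, by simp, by simp⟩
  | cons i l ih =>
    obtain ⟨q, hq, hqx⟩ := ih fun j hj => hp j (by simp [hj])
    refine ⟨p i * C (A i) + q, (degree_add_le _ _).trans_lt (max_lt ?_ hq), fun x => by simp [hqx]⟩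
    refine (degree_mul_le _ _).trans_lt ((add_le_add_right degree_C_le _).trans_lt ?_)
    rw [add_zero]
    exact hp i (by simp)

/-- The polynomial part of a linear form expressed through the pivot `k`. -/
theorem exists_lform_eq_mul {n : ℕ} {p : ℕ → ℝ[X]} {f : ℕ → ℝ → ℝ} {k : ℕ} {l : List ℕ} {A α : ℕ → ℝ}
    {T : ℕ → ℝ → ℝ} {s : Set ℝ} (hk : (p k).degree < (n + 1 : ℕ))
    (hp : ∀ i ∈ l, (p i).degree < (n + 1 : ℕ)) (hp0 : (p 0).degree < n)
    (hf : ∀ i ∈ 0 :: l, ∀ x ∈ s, f i x = f k x * (A i + α i * x + T i x))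
    (hα : ∀ i ∈ l, α i = 0) :
    ∃ P : ℝ[X], P.degree < (n + 1 : ℕ) ∧
      ∀ x ∈ s, lform p f (0 :: k :: l) x = f k x * (P.eval x + lform p T (0 :: l) x) := by
  obtain ⟨q, hq, hqx⟩ := exists_const_lform A hp
  refine ⟨p k + (q + (p 0 * C (A 0) + p 0 * C (α 0) * X)), ?_, fun x hx => ?_⟩
  · have h0 : ∀ c : ℝ, (p 0 * C c).degree < n := fun c => by
      refine (degree_mul_le _ _).trans_lt ((add_le_add_right degree_C_le _).trans_lt ?_)
      rwa [add_zero]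
    refine (degree_add_le _ _).trans_lt (max_lt hk ((degree_add_le _ _).trans_lt (max_lt hq
      ((degree_add_le _ _).trans_lt (max_lt ((h0 _).trans ?_) ?_)))))
    · exact_mod_cast n.lt_succ_self
    · rw [degree_mul_X, Nat.cast_add, Nat.cast_one]
      exact WithBot.add_lt_add_right (by simp) (h0 _)
  · have h1 : lform p f l x = f k x * (q.eval x + lform p T l x) := by
      rw [hqx, lform_congr (g := fun i x => f k x * (A i + T i x)) fun i hi => by
        rw [hf i (by simp [hi]) x hx, hα i hi]; ring, lform_mul_left]
      congr 1
      clear hp hf hα hq hqx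
      induction l with
      | nil => simp
      | cons i l ih => simp only [lform_cons, ih]; ring
    rw [lform_cons, lform_cons, h1, hf 0 (by simp) x hx, lform_cons]
    simp only [eval_add, eval_mul, eval_C, eval_X]
    ring

theorem WChain.card_lt {n : ℕ} {p : ℕ → ℝ[X]} : ∀ {l : List ℕ} {a b : ℝ} {f : ℕ → ℝ → ℝ},
    WChain l a b f → (∀ i ∈ l, (p i).degree < (n + 1 : ℕ)) → (p 0).degree < n →
    (∃ i ∈ 0 :: l, p i ≠ 0) → ∀ Z : Finset ℝ, (∀ z ∈ Z, z ∈ Icc a b) →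
    (∀ z ∈ Z, lform p f (0 :: l) z = 0) → Z.card < l.length * (n + 1) + n := by
  intro l
  induction l with
  | nil =>
    intro a b f h _ hp0 hne Z hZ hz
    have hp : p 0 ≠ 0 := by simpa using hne
    simp only [List.length_nil, zero_mul, zero_add]
    refine card_roots_lt hp hp0 fun z hzZ => ?_
    have := hz z hzZ
    have h' : NZ (f 0) a b := h
    simpa [h'.2 z (hZ z hzZ)] using this
  | cons k l ih =>
    rintro a b f ⟨a', b', μ, A, α, φ, h1, h2, h3, h4, h5, h6, h7⟩ hp hp0 hne Z hZ hz
    rw [List.length_cons]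
    by_cases hall : ∀ i ∈ 0 :: l, p i = 0
    · have hk : p k ≠ 0 := by
        obtain ⟨i, hi, hpi⟩ := hne
        simp only [List.mem_cons] at hi
        rcases hi with rfl | rfl | hi
        · exact absurd (hall 0 (by simp)) hpi
        · exact hpi
        · exact absurd (hall i (by simp [hi])) hpi
      have : Z.card < n + 1 := card_roots_lt hk (hp k (by simp)) fun z hzZ => by
        have := hz z hzZ
        rw [lform_cons, lform_cons, hall 0 (by simp), lform_eq_zero fun i hi => hall i (by simp [hi])]
          at this
        simpa [h3.2 z (hZ z hzZ)] using this
      nlinarith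
    · push Not at hall
      have hp' : ∀ i ∈ 0 :: l, (p i).degree < (n + 1 : ℕ) := by
        intro i hi
        rcases List.mem_cons.1 hi with rfl | hi
        · exact hp0.trans (by exact_mod_cast n.lt_succ_self)
        · exact hp i (by simp [hi])
      obtain ⟨P, hP, hPx⟩ := exists_lform_eq_mul (T := fun i => cau μ (φ i)) (hp k (by simp))
        (fun i hi => hp i (by simp [hi])) hp0 h5 h6
      have := h1.card_zeros_lform_lt h2 (r := l.length * (n + 1) + n) (d := n) (l := 0 :: l) (p := p)
        (φ := φ) (fun i hi => (hp' i hi).trans (by exact_mod_cast (n + 1).lt_succ_self)) h4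
        (ih h7 (fun i hi => hp i (by simp [hi])) hp0 hall) hP hZ fun z hzZ =>
          (mul_eq_zero.1 ((hPx z (hZ z hzZ)).symm.trans (hz z hzZ))).resolve_left
            (h3.2 z (hZ z hzZ))
      nlinarith

theorem NChain.card_lt {n : ℕ} {q : ℕ → ℝ[X]} : ∀ {l : List ℕ} {p : ℕ} {a b : ℝ} {f : ℕ → ℝ → ℝ},
    NChain l p a b f → (∀ i ∈ p :: l, (q i).degree < (n + 1 : ℕ)) →
    (∃ i ∈ p :: l, q i ≠ 0) → ∀ Z : Finset ℝ, (∀ z ∈ Z, z ∈ Icc a b) →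
    (∀ z ∈ Z, lform q f (p :: l) z = 0) → Z.card < (l.length + 1) * (n + 1) := by
  intro l
  induction l with
  | nil =>
    intro p a b f h hq hne Z hZ hz
    have hp : q p ≠ 0 := by simpa using hne
    simp only [List.length_nil, one_mul, zero_add]
    refine card_roots_lt hp (hq p (by simp)) fun z hzZ => ?_
    have := hz z hzZ
    have h' : NZ (f p) a b := h
    simpa [h'.2 z (hZ z hzZ)] using this
  | cons j l ih =>
    rintro p a b f ⟨a', b', μ, φ, h1, h2, h3, h4, h5⟩ hq hne Z hZ hz
    rw [List.length_cons]
    by_cases hall : ∀ i ∈ j :: l, q i = 0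
    · have hk : q p ≠ 0 := by
        obtain ⟨i, hi, hpi⟩ := hne
        rcases List.mem_cons.1 hi with rfl | hi
        · exact hpi
        · exact absurd (hall i hi) hpi
      have : Z.card < n + 1 := card_roots_lt hk (hq p (by simp)) fun z hzZ => by
        have := hz z hzZ
        rw [lform_cons, lform_eq_zero hall] at this
        simpa [h3.2 z (hZ z hzZ)] using this
      nlinarith
    · push Not at hall
      have := h1.card_zeros_lform_lt h2 (r := (l.length + 1) * (n + 1)) (d := n) (l := j :: l) (p := q)
        (φ := φ) (fun i hi => (hq i (List.mem_cons_of_mem _ hi)).trans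
          (by exact_mod_cast (n + 1).lt_succ_self)) (fun i hi => (h4 i hi).1.1)
        (ih h5 (fun i hi => hq i (List.mem_cons_of_mem _ hi)) hall)
        (P := q p) (hq p (by simp)) hZ ?_
      · nlinarith
      · intro z hzZ
        have e := hz z hzZ
        have hzI := hZ z hzZ
        rw [lform_cons, lform_congr (g := fun i x => f p x * cau μ (φ i) x) fun i hi =>
          (h4 i hi).2 z hzI, lform_mul_left, mul_comm, ← mul_add] at e
        exact (mul_eq_zero.1 e).resolve_left (h3.2 z hzI)

theorem lform_perm (p : ℕ → ℝ[X]) (f : ℕ → ℝ → ℝ) {l l' : List ℕ} (h : l.Perm l') (x : ℝ) :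
    lform p f l x = lform p f l' x :=
  (h.map _).sum_eq

theorem lform_range (p : ℕ → ℝ[X]) (f : ℕ → ℝ → ℝ) (m : ℕ) (x : ℝ) :
    lform p f (List.range m) x = ∑ i ∈ Finset.range m, (p i).eval x * f i x := by
  induction m with
  | zero => simp
  | succ m ih =>
    rw [Finset.sum_range_succ, ← ih, List.range_succ, lform, List.map_append, List.sum_append]
    simp [lform]

theorem degree_add_X_sub_C_mul_lt {d : ℕ} {q : ℝ[X]} (c ξ : ℝ) (hq : q.degree < (d : WithBot ℕ)) :
    (C c + (X - C ξ) * q).degree < ((d + 1 : ℕ) : WithBot ℕ) := by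
  refine (degree_add_le _ _).trans_lt (max_lt ?_ ?_)
  · exact degree_C_le.trans_lt (by exact_mod_cast d.succ_pos)
  · rw [degree_mul, degree_X_sub_C, add_comm, Nat.cast_add, Nat.cast_one]
    exact WithBot.add_lt_add_right (by simp) hq

theorem degree_X_sub_C_mul_lt {d : ℕ} {q : ℝ[X]} (ξ : ℝ) (hq : q.degree < (d : WithBot ℕ)) :
    ((X - C ξ) * q).degree < ((d + 1 : ℕ) : WithBot ℕ) := by
  simpa using degree_add_X_sub_C_mul_lt 0 ξ hq

theorem C_add_X_sub_C_mul_ne_zero {c ξ : ℝ} {q : ℝ[X]} (h : c ≠ 0 ∨ q ≠ 0) :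
    C c + (X - C ξ) * q ≠ 0 := by
  intro h0
  have hc : c = 0 := by simpa using congrArg (eval ξ) h0
  refine h.elim (fun h => h hc) fun h => ?_
  rw [hc, C_0, zero_add] at h0
  exact h ((mul_eq_zero.1 h0).resolve_left (X_sub_C_ne_zero ξ))

theorem card_zeros_mul_lt {r : ℕ} {p : ℕ → ℝ[X]} {φ : ℕ → ℝ → ℝ} {l : List ℕ} {a b ξ : ℝ}
    (hξ : ξ ∉ Icc a b)
    (h : ∀ S : Finset ℝ, (∀ s ∈ S, s ∈ Icc a b) → (∀ s ∈ S, lform p φ l s = 0) → S.card < r)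
    (S : Finset ℝ) (hS : ∀ s ∈ S, s ∈ Icc a b)
    (h0 : ∀ s ∈ S, lform (fun i => (X - C ξ) * p i) φ l s = 0) : S.card < r := by
  refine h S hS fun s hs => ?_
  have := h0 s hs
  rw [lform_poly_mul_left, mul_eq_zero] at this
  refine this.resolve_left fun h => hξ ?_
  simp only [eval_sub, eval_X, eval_C, sub_eq_zero] at h
  exact h ▸ hS s hs

/-- Zero count for `c f_k + (x - ξ) ∑ pᵢ fᵢ`, where `k` is the first pivot of the chain. -/
theorem WChain.card_le {n k : ℕ} {p : ℕ → ℝ[X]} {l : List ℕ} {a b c ξ : ℝ} {f : ℕ → ℝ → ℝ}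
    (h : WChain (k :: l) a b f) (hξ : ξ ∈ Icc a b)
    (hp : ∀ i ∈ k :: l, (p i).degree < (n + 1 : ℕ)) (hp0 : (p 0).degree < n)
    (hne : c ≠ 0 ∨ ∃ i ∈ 0 :: k :: l, p i ≠ 0) (Z : Finset ℝ) (hZ : ∀ z ∈ Z, z ∈ Icc a b)
    (hz : ∀ z ∈ Z, c * f k z + (z - ξ) * lform p f (0 :: k :: l) z = 0) :
    Z.card ≤ (k :: l).length * (n + 1) + n := by
  obtain ⟨a', b', μ, A, α, φ, h1, h2, h3, h4, h5, h6, h7⟩ := h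
  rw [List.length_cons]
  by_cases hall : ∀ i ∈ 0 :: l, p i = 0
  · have hk : c ≠ 0 ∨ p k ≠ 0 := by
      refine hne.imp_right ?_
      rintro ⟨i, hi, hpi⟩
      simp only [List.mem_cons] at hi
      rcases hi with rfl | rfl | hi
      · exact absurd (hall 0 (by simp)) hpi
      · exact hpi
      · exact absurd (hall i (by simp [hi])) hpi
    have : Z.card < n + 1 + 1 := card_roots_lt (C_add_X_sub_C_mul_ne_zero (ξ := ξ) hk)
      (degree_add_X_sub_C_mul_lt c ξ (hp k (by simp))) fun z hzZ => by
        have := hz z hzZ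
        rw [lform_cons, lform_cons, hall 0 (by simp), lform_eq_zero fun i hi => hall i (by simp [hi])]
          at this
        have e : f k z * (c + (z - ξ) * (p k).eval z) = 0 := by
          rw [← this]; simp; ring
        simpa using (mul_eq_zero.1 e).resolve_left (h3.2 z (hZ z hzZ))
    nlinarith
  · push Not at hall
    have hp' : ∀ i ∈ 0 :: l, (p i).degree < (n + 1 : ℕ) := by
      intro i hi
      rcases List.mem_cons.1 hi with rfl | hi
      · exact hp0.trans (by exact_mod_cast n.lt_succ_self)
      · exact hp i (by simp [hi])
    obtain ⟨P, hP, hPx⟩ := exists_lform_eq_mul (T := fun i => cau μ (φ i)) (hp k (by simp))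
      (fun i hi => hp i (by simp [hi])) hp0 h5 h6
    have := h1.card_zeros_lform_lt h2 (r := l.length * (n + 1) + n) (d := n + 1) (l := 0 :: l)
      (φ := φ) (p := fun i => (X - C ξ) * p i)
      (fun i hi => (degree_X_sub_C_mul_lt ξ (hp' i hi)).trans
        (by exact_mod_cast (n + 1 + 1).lt_succ_self)) h4
      (card_zeros_mul_lt (h2.subset_compl_right hξ)
        (h7.card_lt (fun i hi => hp i (by simp [hi])) hp0 hall))
      (degree_add_X_sub_C_mul_lt c ξ hP) hZ fun z hzZ => by
        refine (mul_eq_zero.1 ((Eq.symm ?_).trans (hz z hzZ))).resolve_left (h3.2 z (hZ z hzZ))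
        rw [lform_poly_mul_left, hPx z (hZ z hzZ)]
        simp only [eval_add, eval_mul, eval_sub, eval_X, eval_C]
        ring
    nlinarith

theorem NChain.card_le {n : ℕ} {p : ℕ → ℝ[X]} {l : List ℕ} {a b c ξ : ℝ} {f : ℕ → ℝ → ℝ}
    (h : NChain l 0 a b f) (hξ : ξ ∈ Icc a b)
    (hp : ∀ i ∈ l, (p i).degree < (n + 1 : ℕ)) (hp0 : (p 0).degree < n)
    (hne : c ≠ 0 ∨ ∃ i ∈ 0 :: l, p i ≠ 0) (Z : Finset ℝ) (hZ : ∀ z ∈ Z, z ∈ Icc a b)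
    (hz : ∀ z ∈ Z, c * f 0 z + (z - ξ) * lform p f (0 :: l) z = 0) :
    Z.card ≤ l.length * (n + 1) + n := by
  by_cases hall : ∀ i ∈ l, p i = 0
  · have hk : c ≠ 0 ∨ p 0 ≠ 0 := by
      refine hne.imp_right ?_
      rintro ⟨i, hi, hpi⟩
      rcases List.mem_cons.1 hi with rfl | hi
      · exact hpi
      · exact absurd (hall i hi) hpi
    have h3 : NZ (f 0) a b := by
      cases l with
      | nil => exact h
      | cons j l => obtain ⟨a', b', μ, φ, h1, h2, h3, h4, h5⟩ := h; exact h3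
    have : Z.card < n + 1 := card_roots_lt (C_add_X_sub_C_mul_ne_zero (ξ := ξ) hk)
      (degree_add_X_sub_C_mul_lt c ξ hp0) fun z hzZ => by
        have := hz z hzZ
        rw [lform_cons, lform_eq_zero hall] at this
        have e : f 0 z * (c + (z - ξ) * (p 0).eval z) = 0 := by
          rw [← this]; ring
        simpa using (mul_eq_zero.1 e).resolve_left (h3.2 z (hZ z hzZ))
    nlinarith
  · push Not at hall
    cases l with
    | nil => simp at hall
    | cons j l =>
      obtain ⟨a', b', μ, φ, h1, h2, h3, h4, h5⟩ := h
      have := h1.card_zeros_lform_lt h2 (r := (l.length + 1) * (n + 1)) (d := n) (l := j :: l)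
        (φ := φ) (p := fun i => (X - C ξ) * p i) (fun i hi => degree_X_sub_C_mul_lt ξ (hp i hi))
        (fun i hi => (h4 i hi).1.1)
        (card_zeros_mul_lt (h2.subset_compl_right hξ) (h5.card_lt hp hall))
        (degree_add_X_sub_C_mul_lt c ξ hp0) hZ fun z hzZ => by
          refine (mul_eq_zero.1 ((Eq.symm ?_).trans (hz z hzZ))).resolve_left (h3.2 z (hZ z hzZ))
          rw [lform_cons, lform_poly_mul_left, lform_congr (f := f)
            (g := fun i x => f 0 x * cau μ (φ i) x) fun i hi => (h4 i hi).2 z (hZ z hzZ),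
            lform_mul_left]
          simp only [eval_add, eval_mul, eval_sub, eval_X, eval_C]
          ring
      rw [List.length_cons]
      nlinarith

section Chebyshev

variable {W : Type*} [AddCommGroup W] [Module ℝ W] [FiniteDimensional ℝ W]

theorem exists_ne_zero_of_card_lt (E : W →ₗ[ℝ] ℝ → ℝ) (S : Finset ℝ)
    (hS : S.card < Module.finrank ℝ W) : ∃ w ≠ 0, ∀ s ∈ S, E w s = 0 := by
  let T : W →ₗ[ℝ] (S → ℝ) := LinearMap.pi fun s => (LinearMap.proj (s : ℝ)).comp E
  have : LinearMap.ker T ≠ ⊥ := LinearMap.ker_ne_bot_of_finrank_lt (by simpa using hS)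
  obtain ⟨w, hw, hw0⟩ := Submodule.exists_mem_ne_zero_of_ne_bot this
  exact ⟨w, hw0, fun s hs => congrFun (LinearMap.mem_ker.1 hw) ⟨s, hs⟩⟩

theorem exists_interpolant (E : W →ₗ[ℝ] ℝ → ℝ) (S : Finset ℝ)
    (hS : S.card = Module.finrank ℝ W) (hinj : ∀ w, (∀ s ∈ S, E w s = 0) → w = 0) (v : ℝ → ℝ) :
    ∃ w, ∀ s ∈ S, E w s = v s := by
  let T : W →ₗ[ℝ] (S → ℝ) := LinearMap.pi fun s => (LinearMap.proj (s : ℝ)).comp E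
  have hT : Function.Injective T := by
    rw [← LinearMap.ker_eq_bot, LinearMap.ker_eq_bot']
    exact fun w hw => hinj w fun s hs => congrFun hw ⟨s, hs⟩
  have hT' : Function.Surjective T :=
    (LinearMap.injective_iff_surjective_of_finrank_eq_finrank (by simp [hS])).1 hT
  obtain ⟨w, hw⟩ := hT' fun s => v s
  exact ⟨w, fun s hs => congrFun hw ⟨s, hs⟩⟩

/-- In a Chebyshev system, some nonzero element changes sign exactly at the prescribed points. -/
theorem chebyshev_sign (E : W →ₗ[ℝ] ℝ → ℝ) {N : ℕ} (hW : Module.finrank ℝ W = N + 1) {a b : ℝ}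
    (hab : a < b) (hcont : ∀ w, ContinuousOn (E w) (Icc a b))
    (hcount : ∀ w ≠ 0, ∀ Z : Finset ℝ, (∀ z ∈ Z, z ∈ Icc a b) → (∀ z ∈ Z, E w z = 0) → Z.card ≤ N)
    (S : Finset ℝ) (hS : S.card + 1 = N) (hSI : ∀ s ∈ S, s ∈ Ioo a b) :
    ∃ w, ∃ ε : ℝ, (∀ x ∈ Icc a b, 0 ≤ ε * (E w x * ∏ y ∈ S, (x - y))) ∧ ε ≠ 0 ∧
      ∀ x ∈ Icc a b, E w x = 0 → x ∈ insert b S := by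
  have hbS : b ∉ S := fun h => lt_irrefl _ (hSI b h).2
  set B := insert b S with hB
  have hBc : B.card = N := by rw [hB, Finset.card_insert_of_notMem hbS, hS]
  have hBI : ∀ z ∈ B, z ∈ Icc a b := by
    intro z hz
    rcases Finset.mem_insert.1 hz with rfl | hz
    · exact ⟨hab.le, le_rfl⟩
    · exact Ioo_subset_Icc_self (hSI z hz)
  obtain ⟨w, hw0, hw⟩ := exists_ne_zero_of_card_lt E B (by lia)
  have hzeros : ∀ x ∈ Icc a b, E w x = 0 → x ∈ B := by
    intro x hx hx0
    by_contra hxB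
    have := hcount w hw0 (insert x B)
      ((Finset.forall_mem_insert _ _ _).2 ⟨hx, hBI⟩) ((Finset.forall_mem_insert _ _ _).2 ⟨hx0, hw⟩)
    rw [Finset.card_insert_of_notMem hxB] at this
    lia
  obtain ⟨Y, hY, ε, hε, hsign⟩ := (hcont w).exists_sign_prod B hw hzeros
  have hSY : S ⊆ Y := by
    intro x₀ hx₀
    by_contra hx₀Y
    have hx₀I := hSI x₀ hx₀
    -- an interval around `x₀` free of the other points
    have hopen : IsOpen (Ioo a b \ ((B.erase x₀ : Finset ℝ) : Set ℝ)) :=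
      isOpen_Ioo.sdiff (Finset.isClosed _)
    obtain ⟨η, hη, hball⟩ := Metric.isOpen_iff.1 hopen x₀ ⟨hx₀I, by simp⟩
    rw [Real.ball_eq_Ioo] at hball
    set u := x₀ - η / 2 with hu
    set v := x₀ + η / 2 with hv
    have hux : u < x₀ := by linarith
    have hxv : x₀ < v := by linarith
    have huv : ∀ t ∈ Icc u v, t ∈ Ioo a b ∧ t ∉ B.erase x₀ := fun t ht =>
      hball ⟨by linarith [ht.1], by linarith [ht.2]⟩
    have huI := huv u ⟨le_rfl, by linarith⟩
    have hvI := huv v ⟨by linarith, le_rfl⟩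
    have hGu : E w u ≠ 0 := fun h => huI.2 (Finset.mem_erase.2
      ⟨hux.ne, hzeros u (Ioo_subset_Icc_self huI.1) h⟩)
    have hGv : E w v ≠ 0 := fun h => hvI.2 (Finset.mem_erase.2
      ⟨hxv.ne', hzeros v (Ioo_subset_Icc_self hvI.1) h⟩)
    have hprod : 0 < (∏ y ∈ Y, (u - y)) * ∏ y ∈ Y, (v - y) := by
      rw [← Finset.prod_mul_distrib]
      refine Finset.prod_pos fun y hy => ?_
      have hyE : y ∈ B.erase x₀ := Finset.mem_erase.2 ⟨fun h => hx₀Y (h ▸ hy), hY hy⟩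
      by_contra! hc
      refine (huv y ⟨?_, ?_⟩).2 hyE
      · by_contra! h
        nlinarith [mul_pos (sub_pos.2 h) (sub_pos.2 (h.trans (hux.trans hxv)))]
      · by_contra! h
        nlinarith [mul_pos (sub_pos.2 h) (sub_pos.2 ((hux.trans hxv).trans h))]
    have hGG : 0 < E w u * E w v := by
      have h1 := hsign u (Ioo_subset_Icc_self huI.1)
      have h2 := hsign v (Ioo_subset_Icc_self hvI.1)
      have h3 : 0 ≤ (ε ^ 2 * ((∏ y ∈ Y, (u - y)) * ∏ y ∈ Y, (v - y))) * (E w u * E w v) := by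
        have := mul_nonneg h1 h2
        linarith
      have h4 : 0 < ε ^ 2 * ((∏ y ∈ Y, (u - y)) * ∏ y ∈ Y, (v - y)) := by positivity
      exact lt_of_le_of_ne (nonneg_of_mul_nonneg_right h3 h4) (mul_ne_zero hGu hGv).symm
    have huB : u ∉ B := fun h => huI.2 (Finset.mem_erase.2 ⟨hux.ne, h⟩)
    have hcardu : (insert u B).card = N + 1 := by rw [Finset.card_insert_of_notMem huB, hBc]
    have huBI : ∀ z ∈ insert u B, z ∈ Icc a b := (Finset.forall_mem_insert _ _ _).2 ⟨Ioo_subset_Icc_self huI.1, hBI⟩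
    obtain ⟨w', hw'⟩ := exists_interpolant E (insert u B) (by rw [hcardu, hW])
      (fun y hy => by
        by_contra hy0
        have := hcount y hy0 _ huBI hy
        lia) (fun t => if t = x₀ then 1 else 0)
    have hx₀B : x₀ ∈ B := Finset.mem_insert_of_mem hx₀
    have hw'x : E w' x₀ = 1 := by
      simpa using hw' x₀ (Finset.mem_insert_of_mem hx₀B)
    have hev : ∀ᶠ θ : ℝ in nhdsWithin 0 (Ioi 0), 0 < θ ∧
        0 < (E w u - θ * E w u * E w' u) * E w u ∧ 0 < (E w v - θ * E w u * E w' v) * E w u := by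
      refine eventually_mem_nhdsWithin.and (Eventually.and ?_ ?_) <;>
        refine (ContinuousAt.eventually_lt (g := fun θ : ℝ => (E w _ - θ * E w u * E w' _) * E w u)
          continuousAt_const (by fun_prop) ?_).filter_mono nhdsWithin_le_nhds
      · simpa using hGu
      · simpa [mul_comm] using hGG
    obtain ⟨θ, hθ, h1, h2⟩ := hev.exists
    have hF : ∀ t, E (w - (θ * E w u) • w') t = E w t - θ * E w u * E w' t := fun t => by simp
    have hFx : E (w - (θ * E w u) • w') x₀ = - (θ * E w u) := by
      rw [hF, hw x₀ hx₀B, hw'x]; ring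
    have hne : w - (θ * E w u) • w' ≠ 0 := by
      intro h
      rw [h] at hFx
      simp [hθ.ne', hGu] at hFx
    have hc := hcont (w - (θ * E w u) • w')
    have hIVT : ∀ s t, s < t → s ∈ Icc a b → t ∈ Icc a b →
        E (w - (θ * E w u) • w') s * E (w - (θ * E w u) • w') t < 0 →
        ∃ z ∈ Ioo s t, E (w - (θ * E w u) • w') z = 0 := by
      intro s t hst hs ht hneg
      have hst' := hc.mono (Icc_subset_Icc hs.1 ht.2)
      rcases mul_neg_iff.1 hneg with h | h
      · exact intermediate_value_Ioo' hst.le hst' ⟨h.2, h.1⟩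
      · exact intermediate_value_Ioo hst.le hst' ⟨h.1, h.2⟩
    obtain ⟨z₁, hz₁, hz₁0⟩ := hIVT u x₀ hux (Ioo_subset_Icc_self huI.1)
      (Ioo_subset_Icc_self hx₀I) (by rw [hFx, hF]; nlinarith [mul_pos hθ h1])
    obtain ⟨z₂, hz₂, hz₂0⟩ := hIVT x₀ v hxv (Ioo_subset_Icc_self hx₀I)
      (Ioo_subset_Icc_self hvI.1) (by rw [hFx, hF]; nlinarith [mul_pos hθ h2])
    have hz₁I := huv z₁ ⟨hz₁.1.le, by linarith [hz₁.2]⟩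
    have hz₂I := huv z₂ ⟨by linarith [hz₂.1], hz₂.2.le⟩
    have := hcount _ hne (insert z₁ (insert z₂ (B.erase x₀))) (by
      intro z hz
      simp only [Finset.mem_insert] at hz
      rcases hz with rfl | rfl | hz
      · exact Ioo_subset_Icc_self hz₁I.1
      · exact Ioo_subset_Icc_self hz₂I.1
      · exact hBI z (Finset.mem_of_mem_erase hz)) (by
      intro z hz
      simp only [Finset.mem_insert] at hz
      rcases hz with rfl | rfl | hz
      · exact hz₁0
      · exact hz₂0
      · have hzB := Finset.mem_of_mem_erase hz
        rw [hF, hw z hzB, hw' z (Finset.mem_insert_of_mem hzB), if_neg (Finset.ne_of_mem_erase hz)]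
        ring)
    rw [Finset.card_insert_of_notMem, Finset.card_insert_of_notMem hz₂I.2,
      Finset.card_erase_of_mem hx₀B] at this
    · have : 0 < B.card := Finset.card_pos.2 ⟨_, hx₀B⟩
      lia
    · rw [Finset.mem_insert, not_or]
      exact ⟨(hz₁.2.trans hz₂.1).ne, hz₁I.2⟩
  by_cases hbY : b ∈ Y
  · have hYB : Y = insert b S := Finset.Subset.antisymm hY (Finset.insert_subset hbY hSY)
    refine ⟨w, -ε, fun x hx => ?_, neg_ne_zero.2 hε, hzeros⟩
    rcases eq_or_lt_of_le hx.2 with rfl | hxb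
    · rw [hw x (Finset.mem_insert_self _ _)]; simp
    · have := hsign x hx
      rw [hYB, Finset.prod_insert hbS] at this
      have h1 : 0 ≤ (-ε * (E w x * ∏ y ∈ S, (x - y))) * (b - x) := by linarith
      exact nonneg_of_mul_nonneg_left h1 (sub_pos.2 hxb)
  · have hYS : Y = S := Finset.Subset.antisymm
      (fun y hy => (Finset.mem_insert.1 (hY hy)).resolve_left fun h => hbY (h ▸ hy)) hSY
    exact ⟨w, ε, hYS ▸ hsign, hε, hzeros⟩

end Chebyshev


/-- If `c f_k + (x - ξ) ∑ pᵢ fᵢ` never has too many zeros, then the weight of the quadrature rule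
at the node `ξ` has the sign of `f_k(ξ) q(ξ)`. -/
theorem Good.weight_pos {ν : Measure ℝ} {a b ξ lc : ℝ} (h : Good ν a b) {m k N : ℕ} {d : ℕ → ℕ}
    {f : ℕ → ℝ → ℝ} (hf : ∀ i < m, ContinuousOn (f i) (Icc a b)) (hk : k < m)
    (hξ : ξ ∈ Ioo a b) (hN : ∑ i ∈ Finset.range m, d i = N)
    (hcount : ∀ (c : ℝ) (p : ℕ → ℝ[X]), (∀ i < m, (p i).degree < (d i : WithBot ℕ)) →
      (c ≠ 0 ∨ ∃ i < m, p i ≠ 0) → ∀ Z : Finset ℝ, (∀ z ∈ Z, z ∈ Icc a b) →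
      (∀ z ∈ Z, c * f k z + (z - ξ) * ∑ i ∈ Finset.range m, (p i).eval z * f i z = 0) →
      Z.card ≤ N)
    {q : ℝ[X]} {S : Finset ℝ} (hlc : lc ≠ 0) (hq : ∀ x, q.eval x = lc * ∏ y ∈ S, (x - y))
    (hS : S.card + 1 = N) (hSI : ∀ s ∈ S, s ∈ Ioo a b) (hξS : ξ ∉ S)
    (hfξ : f k ξ ≠ 0)
    (horth : ∀ i < m, ∀ p : ℝ[X], p.degree < (d i : WithBot ℕ) →
      ∫ x, q.eval x * ((x - ξ) * (p.eval x * f i x)) ∂ν = 0) :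
    0 < (∫ x, q.eval x * f k x ∂ν) * (f k ξ * q.eval ξ) := by
  have hfin : ∀ j : Fin m, Module.Finite ℝ (degreeLT ℝ (d j)) := fun j =>
    Module.Finite.equiv (degreeLTEquiv ℝ _).symm
  let E : (ℝ × ∀ j : Fin m, degreeLT ℝ (d j)) →ₗ[ℝ] ℝ → ℝ :=
    { toFun := fun w x => w.1 * f k x + (x - ξ) * ∑ j : Fin m, (w.2 j : ℝ[X]).eval x * f j x
      map_add' := fun w w' => by
        ext x
        simp only [Prod.fst_add, Prod.snd_add, Pi.add_apply, Submodule.coe_add, eval_add, add_mul,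
          Finset.sum_add_distrib]
        ring
      map_smul' := fun r w => by
        ext x
        simp only [Prod.smul_fst, Prod.smul_snd, Pi.smul_apply, Submodule.coe_smul, eval_smul,
          smul_eq_mul, mul_assoc, ← Finset.mul_sum, RingHom.id_apply]
        ring }
  have hE : ∀ w x, E w x =
      w.1 * f k x + (x - ξ) * ∑ j : Fin m, (w.2 j : ℝ[X]).eval x * f j x := fun _ _ => rfl
  have hW : Module.finrank ℝ (ℝ × ∀ j : Fin m, degreeLT ℝ (d j)) = N + 1 := by
    rw [Module.finrank_prod, Module.finrank_pi_fintype, Module.finrank_self, add_comm, ← hN,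
      Finset.sum_range]
    congr 1
    refine Finset.sum_congr rfl fun j _ => ?_
    rw [(degreeLTEquiv ℝ (d j)).finrank_eq, Module.finrank_fin_fun]
  obtain ⟨⟨c, p⟩, ε, hsign, hε, hzero⟩ := chebyshev_sign E hW (hξ.1.trans hξ.2)
    (fun w => by
      have := hf k hk
      have h2 : ∀ j : Fin m, ContinuousOn (f j) (Icc a b) := fun j => hf j j.2
      have : ContinuousOn (fun x => w.1 * f k x +
        (x - ξ) * ∑ j : Fin m, (w.2 j : ℝ[X]).eval x * f j x) (Icc a b) := by fun_prop
      exact this)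
    (fun w hw Z hZ hz => by
      refine hcount w.1 (fun i => if hi : i < m then (w.2 ⟨i, hi⟩ : ℝ[X]) else 0) (fun i hi => ?_) ?_
        Z hZ fun z hzZ => ?_
      · simpa [hi] using mem_degreeLT.1 (w.2 ⟨i, hi⟩).2
      · by_contra! hc
        refine hw (Prod.ext hc.1 (funext fun j => Subtype.ext ?_))
        simpa using hc.2 j j.2
      · rw [Finset.sum_range]
        simpa [hE] using hz z hzZ)
    S hS hSI
  have hpc : ContinuousOn (fun x => ∏ y ∈ S, (x - y)) (Icc a b) := by fun_prop
  have hfk := hf k hk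
  have hEc : ContinuousOn (E (c, p)) (Icc a b) := by
    have h2 : ∀ j : Fin m, ContinuousOn (f j) (Icc a b) := fun j => hf j j.2
    have : ContinuousOn (fun x => c * f k x +
      (x - ξ) * ∑ j : Fin m, (p j : ℝ[X]).eval x * f j x) (Icc a b) := by fun_prop
    exact this
  have hpos := h.integral_pos (g := fun x => ε * (E (c, p) x * ∏ y ∈ S, (x - y)))
    (continuousOn_const.mul (hEc.mul hpc)) hsign (insert b S)
    fun t ht h0 => by
      rcases mul_eq_zero.1 ((mul_eq_zero.1 h0).resolve_left hε) with h1 | h1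
      · exact hzero t ht h1
      · obtain ⟨y, hy, hy0⟩ := Finset.prod_eq_zero_iff.1 h1
        rw [sub_eq_zero.1 hy0]
        exact Finset.mem_insert_of_mem hy
  have hint : ∫ x, ε * (E (c, p) x * ∏ y ∈ S, (x - y)) ∂ν =
      ε * c / lc * ∫ x, q.eval x * f k x ∂ν := by
    have e : ∀ x, ε * (E (c, p) x * ∏ y ∈ S, (x - y)) = ε * c / lc * (q.eval x * f k x) +
        ε / lc * ∑ j : Fin m, q.eval x * ((x - ξ) * ((p j : ℝ[X]).eval x * f j x)) := fun x => by
      rw [hE, ← Finset.mul_sum, ← Finset.mul_sum, hq]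
      field_simp
    have hi : ∀ j : Fin m, ContinuousOn
        (fun x => q.eval x * ((x - ξ) * ((p j : ℝ[X]).eval x * f j x))) (Icc a b) := fun j => by
      have := hf j j.2
      fun_prop
    simp only [e]
    rw [integral_add (h.integrable (by fun_prop)) (h.integrable (by fun_prop)),
      integral_const_mul, integral_const_mul,
      integral_finsetSum _ fun j _ => h.integrable (hi j),
      Finset.sum_eq_zero fun (j : Fin m) _ =>
        horth j j.2 _ (mem_degreeLT.1 (p j).2), mul_zero, add_zero]
  rw [hint] at hpos
  have hc : c ≠ 0 := by
    rintro rfl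
    simp at hpos
  have h1 := hsign ξ (Ioo_subset_Icc_self hξ)
  rw [hE, sub_self, zero_mul, add_zero] at h1
  have h2 : 0 ≤ ε * c / lc * (f k ξ * q.eval ξ) := by
    rw [hq]
    convert h1 using 1
    field_simp
  have h3 : f k ξ * q.eval ξ ≠ 0 := by
    rw [hq]
    exact mul_ne_zero hfξ (mul_ne_zero hlc (Finset.prod_ne_zero_iff.2 fun y hy h0 =>
      hξS (sub_eq_zero.1 h0 ▸ hy)))
  have h4 : ε * c / lc ≠ 0 := div_ne_zero (mul_ne_zero hε hc) hlc
  have h5 := mul_pos hpos (lt_of_le_of_ne h2 (mul_ne_zero h4 h3).symm)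
  have h6 : 0 < (ε * c / lc) ^ 2 * ((∫ x, q.eval x * f k x ∂ν) * (f k ξ * q.eval ξ)) := by
    linarith
  exact pos_of_mul_pos_right h6 (sq_nonneg _)

section Spectral

variable {H : Type*} [NormedAddCommGroup H] [InnerProductSpace ℂ H] [CompleteSpace H]

/-- The spectral measure of a vector for a self-adjoint operator with spectrum in `[a, b]`. -/
theorem exists_spectral_measure {B : H →L[ℂ] H} (_hB : IsSelfAdjoint B) (e : H) {a b : ℝ}
    (hab : a ≤ b) (hs : spectrum ℝ B ⊆ Icc a b) :
    ∃ τ : Measure ℝ, IsFiniteMeasure τ ∧ τ (Icc a b)ᶜ = 0 ∧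
      ∀ g : ℝ → ℝ, ContinuousOn g (Icc a b) → ∫ t, g t ∂τ = (inner ℂ e (cfc g B e)).re := by
  have hext : ∀ g : CompactlySupportedContinuousMap (Icc a b) ℝ, Continuous (IccExtend hab g) :=
    fun g => g.continuous.Icc_extend'
  let Λ : CompactlySupportedContinuousMap (Icc a b) ℝ →ₚ[ℝ] ℝ := PositiveLinearMap.mk₀
    { toFun := fun g => (inner ℂ e (cfc (IccExtend hab g) B e)).re
      map_add' := fun g g' => by
        have : IccExtend hab (g + g') = fun x => IccExtend hab g x + IccExtend hab g' x := rfl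
        rw [this, cfc_add (a := B) _ _ (hext g).continuousOn (hext g').continuousOn]
        simp
      map_smul' := fun r g => by
        have : IccExtend hab (r • g) = fun x => r * IccExtend hab g x := rfl
        rw [this, cfc_const_mul r _ B (hext g).continuousOn]
        simp [inner_smul_right_eq_smul] }
    (fun g hg => by
      have h1 : 0 ≤ cfc (IccExtend hab g) B := cfc_nonneg fun x _ => hg _
      have h2 := ((ContinuousLinearMap.nonneg_iff_isPositive _).1 h1).re_inner_nonneg_right e
      exact h2)
  have hfin : IsFiniteMeasure (RealRMK.rieszMeasure Λ) := inferInstance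
  refine ⟨(RealRMK.rieszMeasure Λ).map Subtype.val, inferInstance, ?_, fun g hg => ?_⟩
  · rw [Measure.map_apply measurable_subtype_coe measurableSet_Icc.compl]
    simp
  · let G : CompactlySupportedContinuousMap (Icc a b) ℝ :=
      ⟨⟨fun x => g x, hg.domRestrict⟩, HasCompactSupport.of_compactSpace _⟩
    rw [(MeasurableEmbedding.subtype_coe measurableSet_Icc).integral_map]
    have h1 := RealRMK.integral_rieszMeasure Λ G
    have h2 : Λ G = (inner ℂ e (cfc (IccExtend hab G) B e)).re := rfl
    rw [h2] at h1
    refine h1.trans ?_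
    rw [cfc_congr (f := IccExtend hab G) (g := g)]
    intro x hx
    exact IccExtend_of_mem hab _ (hs hx)

/-- Rank one perturbation: the inverse of `A + m`, where `m` is the resolvent function of a
self-adjoint operator. -/
theorem exists_inverse_measure {T : H →L[ℂ] H} (hT : IsSelfAdjoint T) (e : H) {a b A : ℝ}
    (hab : a ≤ b) (hA : A ≠ 0) {m : ℝ → ℝ}
    (hres : ∀ z ∉ Icc a b, ∃ M : H →L[ℂ] H, (∀ v, M ((z : ℂ) • v - T v) = v) ∧
      (∀ v, (z : ℂ) • M v - T (M v) = v) ∧ inner ℂ e (M e) = (m z : ℂ))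
    (hne : ∀ z ∉ Icc a b, A + m z ≠ 0) :
    ∃ τ : Measure ℝ, IsFiniteMeasure τ ∧ τ (Icc a b)ᶜ = 0 ∧
      ∀ z ∉ Icc a b, 1 / (A + m z) = 1 / A - 1 / A ^ 2 * cau τ (fun _ => 1) z := by
  have hAC : (A : ℂ) ≠ 0 := by exact_mod_cast hA
  set B : H →L[ℂ] H := T - (A : ℂ)⁻¹ • InnerProductSpace.rankOne ℂ e e with hBdef
  have hBv : ∀ v, B v = T v - ((A : ℂ)⁻¹ * inner ℂ e v) • e := fun v => by
    simp [hBdef, smul_smul]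
  have hB : IsSelfAdjoint B := by
    refine hT.sub (IsSelfAdjoint.smul ?_ ?_)
    · rw [IsSelfAdjoint, star_inv₀]; simp
    · rw [ContinuousLinearMap.isSelfAdjoint_iff', InnerProductSpace.adjoint_rankOne]
  have hs : spectrum ℝ B ⊆ Icc a b := by
    intro z hz
    by_contra hzI
    obtain ⟨M, hM1, hM2, hM3⟩ := hres z hzI
    have hmz : (A : ℂ) + m z ≠ 0 := by exact_mod_cast hne z hzI
    refine hz (spectrum.mem_resolventSet_iff.2 ?_)
    rw [ContinuousLinearMap.isUnit_iff_bijective]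
    have hop : ∀ v, (algebraMap ℝ (H →L[ℂ] H) z - B) v =
        (z : ℂ) • v - T v + ((A : ℂ)⁻¹ * inner ℂ e v) • e := fun v => by
      rw [sub_apply, hBv, Algebra.algebraMap_eq_smul_one]
      simp
      abel
    constructor
    · rw [injective_iff_map_eq_zero]
      intro v hv
      rw [hop] at hv
      have h1 : v + ((A : ℂ)⁻¹ * inner ℂ e v) • M e = 0 := by
        have := congrArg M hv
        rwa [map_add, map_smul, hM1, map_zero] at this
      have h2 : (inner ℂ e v : ℂ) = 0 := by
        have := congrArg (inner ℂ e) h1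
        rw [inner_add_right, inner_smul_right, hM3, inner_zero_right] at this
        have h3 : (inner ℂ e v : ℂ) * (A + m z) = 0 := by
          field_simp at this
          linear_combination this
        exact (mul_eq_zero.1 h3).resolve_right hmz
      simpa [h2] using h1
    · intro v
      refine ⟨M v - (inner ℂ e (M v) / (A + m z) : ℂ) • M e, ?_⟩
      rw [hop]
      have h1 := hM2 v
      have h2 := hM2 e
      have h3 : ∀ c d : ℂ, c = d →
          ((z : ℂ) • M v - T (M v)) - c • ((z : ℂ) • M e - T (M e)) + d • e = v := fun c d hcd => by
        rw [h1, h2, hcd]; abel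
      refine Eq.trans ?_ (h3 (inner ℂ e (M v) / (A + m z)) ((A : ℂ)⁻¹ * inner ℂ e
        (M v - (inner ℂ e (M v) / (A + m z) : ℂ) • M e)) ?_)
      · simp only [map_sub, map_smul, smul_sub]
        rw [smul_comm (z : ℂ) (_ : ℂ) (M e)]
        abel
      · rw [inner_sub_right, inner_smul_right, hM3]
        field_simp
        ring
  obtain ⟨τ, hτ1, hτ2, hτ3⟩ := exists_spectral_measure hB e hab hs
  refine ⟨τ, hτ1, hτ2, fun z hz => ?_⟩
  obtain ⟨M, hM1, hM2, hM3⟩ := hres z hz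
  have hmz : (A : ℂ) + m z ≠ 0 := by exact_mod_cast hne z hz
  have hcont : ContinuousOn (fun t : ℝ => 1 / (z - t)) (Icc a b) :=
    continuousOn_div_sub continuousOn_const hz
  set u := cfc (fun t : ℝ => 1 / (z - t)) B e with hu
  have hinv : (z : ℂ) • u - B u = e := by
    have h1 : (algebraMap ℝ (H →L[ℂ] H) z - B) * cfc (fun t : ℝ => 1 / (z - t)) B = 1 := by
      have h2 : algebraMap ℝ (H →L[ℂ] H) z - B = cfc (fun t : ℝ => z - t) B := by
        rw [cfc_sub (fun _ => z) (fun t => t) B (by fun_prop) (by fun_prop), cfc_const z B,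
          cfc_id' ℝ B]
      rw [h2, ← cfc_mul (fun t : ℝ => z - t) (fun t => 1 / (z - t)) B (by fun_prop) (hcont.mono hs),
        ← cfc_const_one ℝ B]
      refine cfc_congr fun t ht => ?_
      have := sub_ne_zero_of_notMem hz (hs ht)
      field_simp
    have h2 := congrArg (fun L : H →L[ℂ] H => L e) h1
    rw [Algebra.algebraMap_eq_smul_one] at h2
    simpa only [mul_apply_eq_comp, sub_apply, ← hu,
      smul_apply, one_apply_eq_self, Complex.coe_smul] using h2
  have h1 : u + ((A : ℂ)⁻¹ * inner ℂ e u) • M e = M e := by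
    rw [hBv, ← sub_add] at hinv
    have := congrArg M hinv
    rwa [map_add, map_smul, hM1] at this
  have h2 : (inner ℂ e u : ℂ) = A * m z / (A + m z) := by
    have := congrArg (inner ℂ e) h1
    rw [inner_add_right, inner_smul_right, hM3] at this
    field_simp at this ⊢
    linear_combination this
  have h3 : cau τ (fun _ => 1) z = A * m z / (A + m z) := by
    rw [cau, hτ3 _ hcont, ← hu, h2]
    norm_cast
  rw [h3]
  have := hne z hz
  field_simp
  ring

end Spectral

namespace Good

variable {μ : Measure ℝ} {a b : ℝ}

theorem le (h : Good μ a b) : a ≤ b := by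
  by_contra hab
  have := h.conc
  rw [Icc_eq_empty hab, compl_empty] at this
  exact h.infinite ∅ (by simpa using this)

theorem tendsto_cau (h : Good μ a b) {φ : ℝ → ℝ} (hφ : ContinuousOn φ (Icc a b)) :
    Tendsto (cau μ φ) atTop (nhds 0) := by
  refine squeeze_zero_norm' (a := fun z => (∫ t, |φ t| ∂μ) / (z - b)) ?_ ?_
  · filter_upwards [eventually_gt_atTop b] with z hz
    have hzI : z ∉ Icc a b := fun hm => hm.2.not_gt hz
    refine (norm_integral_le_integral_norm _).trans ?_
    rw [← integral_div]
    refine integral_mono_ae (h.integrable_cau hφ hzI).norm ((h.integrable hφ.abs).div_const _) ?_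
    filter_upwards [h.ae_mem] with t ht
    rw [norm_div, Real.norm_eq_abs, Real.norm_eq_abs, abs_of_pos (by linarith [ht.2] : 0 < z - t)]
    have := sub_pos.2 hz
    gcongr
    exact ht.2
  · exact tendsto_const_nhds.div_atTop (tendsto_atTop_add_const_right _ _ tendsto_id)

theorem eq_zero_of_cau_eq (h : Good μ a b) {φ : ℝ → ℝ} (hφ : ContinuousOn φ (Icc a b)) {p : ℝ[X]}
    (hp : ∀ z > b, cau μ φ z = p.eval z) : p = 0 := by
  have h1 := (h.tendsto_cau hφ).congr' ((eventually_gt_atTop b).mono hp)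
  exact leadingCoeff_eq_zero.1 (p.tendsto_nhds_iff.1 h1).1

theorem exists_mulOp (h : Good μ a b) {g : ℝ → ℝ} (hg : ContinuousOn g (Icc a b)) :
    ∃ M : Lp ℂ 2 μ →L[ℂ] Lp ℂ 2 μ, ∀ f, M f =ᵐ[μ] fun t => (g t : ℂ) * f t := by
  have := h.finite
  obtain ⟨C, hC⟩ := isCompact_Icc.exists_bound_of_continuousOn hg
  have hm : MemLp (fun t => (g t : ℂ)) ⊤ μ :=
    memLp_top_of_bound (Complex.continuous_ofReal.comp_aestronglyMeasurable (h.integrable hg).1) C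
      (h.ae_mem.mono fun t ht => by simpa using hC t ht)
  refine ⟨(ContinuousLinearMap.mul ℂ ℂ).holderL μ ⊤ 2 2 hm.toLp, fun f => ?_⟩
  filter_upwards [(ContinuousLinearMap.mul ℂ ℂ).coeFn_holder (r := 2) hm.toLp f, hm.coeFn_toLp]
    with t h1 h2
  exact h1.trans (by rw [h2]; rfl)

theorem add_measure (h : Good μ a b) {τ : Measure ℝ} [IsFiniteMeasure τ] (hτ : τ (Icc a b)ᶜ = 0) :
    Good (τ + μ) a b := by
  have := h.finite
  refine ⟨inferInstance, by simp [hτ, h.conc], fun S hS => h.infinite S ?_⟩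
  rw [Measure.add_apply, add_eq_zero] at hS
  exact hS.2

theorem exists_poly_eq (h : Good μ a b) {φ : ℝ → ℝ} (hφ : ContinuousOn φ (Icc a b)) (p : ℝ[X]) :
    ∃ q : ℝ[X], ∀ z ∉ Icc a b,
      p.eval z * cau μ φ z = q.eval z + cau μ (fun t => p.eval t * φ t) z := by
  obtain ⟨q, -, hq⟩ := h.exists_polyPart p.natDegree (degree_le_natDegree.trans_lt
    (by exact_mod_cast p.natDegree.lt_succ_self)) hφ
  exact ⟨q, hq⟩

/-- The inverse of `A + μ̂` when `A ≠ 0`. -/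
theorem exists_inverse_one (h : Good μ a b) {A : ℝ} (hA : A ≠ 0)
    (hne : ∀ z ∉ Icc a b, A + cau μ (fun _ => 1) z ≠ 0) :
    ∃ τ, Good τ a b ∧ ∀ z ∉ Icc a b,
      1 / (A + cau μ (fun _ => 1) z) = 1 / A - 1 / A ^ 2 * cau τ (fun _ => 1) z := by
  have := h.finite
  obtain ⟨T, hT⟩ := h.exists_mulOp continuousOn_id
  have he : MemLp (fun _ : ℝ => (1 : ℂ)) 2 μ := memLp_const 1
  have hTsa : IsSelfAdjoint T := by
    rw [ContinuousLinearMap.isSelfAdjoint_iff_isSymmetric]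
    intro f g
    simp only [ContinuousLinearMap.coe_coe, L2.inner_def]
    refine integral_congr_ae ?_
    filter_upwards [hT f, hT g] with t h1 h2
    simp only [h1, h2, id, RCLike.inner_apply, map_mul, Complex.conj_ofReal]
    ring
  obtain ⟨τ, hτ1, hτ2, hτ3⟩ := exists_inverse_measure hTsa he.toLp h.le hA
    (m := cau μ fun _ => 1) (fun z hz => by
      obtain ⟨M, hM⟩ := h.exists_mulOp
        (continuousOn_div_sub (φ := fun _ => 1) continuousOn_const hz)
      refine ⟨M, fun v => Lp.ext ?_, fun v => Lp.ext ?_, ?_⟩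
      · filter_upwards [hM ((z : ℂ) • v - T v), Lp.coeFn_sub ((z : ℂ) • v) (T v),
          Lp.coeFn_smul (z : ℂ) v, hT v, h.ae_mem] with t h1 h2 h3 h4 ht
        have : (z : ℂ) - t ≠ 0 := by exact_mod_cast sub_ne_zero_of_notMem hz ht
        rw [h1, h2, Pi.sub_apply, h3, h4]
        push_cast
        simp only [id, Pi.smul_apply, smul_eq_mul]
        field_simp
      · filter_upwards [hM v, Lp.coeFn_sub ((z : ℂ) • M v) (T (M v)),
          Lp.coeFn_smul (z : ℂ) (M v), hT (M v), h.ae_mem] with t h1 h2 h3 h4 ht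
        have : (z : ℂ) - t ≠ 0 := by exact_mod_cast sub_ne_zero_of_notMem hz ht
        rw [h2, Pi.sub_apply, h3, h4, Pi.smul_apply, h1]
        push_cast
        simp only [id, smul_eq_mul]
        field_simp
      · rw [L2.inner_def, cau, ← integral_complex_ofReal]
        refine integral_congr_ae ?_
        filter_upwards [hM he.toLp, he.coeFn_toLp] with t h1 h2
        rw [h1, h2]
        simp) hne
  refine ⟨τ, ⟨hτ1, hτ2, fun S hS => ?_⟩, hτ3⟩
  set q : ℝ[X] := ∏ s ∈ S, (X - C s) with hq
  have hq0 : q ≠ 0 := Finset.prod_ne_zero_iff.2 fun s _ => X_sub_C_ne_zero s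
  have hqS : ∀ φ : ℝ → ℝ, ∀ z, cau τ (fun t => q.eval t * φ t) z = 0 := fun φ z => by
    refine integral_eq_zero_of_ae ?_
    have hS' : ∀ᵐ t ∂τ, t ∈ (S : Set ℝ) := hS
    filter_upwards [hS'] with t ht
    have : q.eval t = 0 := by
      rw [hq, eval_prod]
      exact Finset.prod_eq_zero ht (by simp)
    simp [this]
  have hg := h.add_measure hτ2
  have hadd : ∀ {φ : ℝ → ℝ}, ContinuousOn φ (Icc a b) → ∀ z ∉ Icc a b,
      cau (τ + μ) φ z = cau τ φ z + cau μ φ z := fun {φ} hφ z hz => by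
    have := hg.integrable_cau hφ hz
    rw [integrable_add_measure] at this
    exact integral_add_measure this.1 this.2
  have hone : ContinuousOn (fun _ : ℝ => (1 : ℝ)) (Icc a b) := continuousOn_const
  obtain ⟨r₁, hr₁⟩ := hg.exists_poly_eq hone q
  obtain ⟨r₂, hr₂⟩ := h.exists_poly_eq hone q
  set D : ℝ[X] := C (1 / A) * q - C (1 / A ^ 2) * (r₁ - r₂) with hD
  have hDz : ∀ z ∉ Icc a b, D.eval z * (A + cau μ (fun _ => 1) z) = q.eval z := fun z hz => by
    have h1 := hr₁ z hz
    rw [hadd hone z hz, hadd (by fun_prop) z hz, hqS] at h1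
    have h3 : D.eval z = q.eval z * (1 / A - 1 / A ^ 2 * cau τ (fun _ => 1) z) := by
      simp only [hD, eval_sub, eval_mul, eval_C]
      linear_combination (1 / A ^ 2) * (h1 - hr₂ z hz)
    rw [h3, ← hτ3 z hz]
    field_simp [hne z hz]
  have hD0 : D ≠ 0 := by
    intro h0
    refine hq0 (eq_zero_of_infinite_isRoot q (Set.Infinite.mono (s := Ioi b) ?_ (Ioi_infinite b)))
    intro z hz
    have := hDz z fun hm => hm.2.not_gt hz
    rw [h0, eval_zero, zero_mul] at this
    exact this.symm
  obtain ⟨r₃, hr₃⟩ := h.exists_poly_eq hone (D * D)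
  have hDc : ContinuousOn (fun t => (D * D).eval t * 1) (Icc a b) := by fun_prop
  have hz0 := h.eq_zero_of_cau_eq hDc (p := D * (q - C A * D) - r₃) fun z hz => by
    have hzI : z ∉ Icc a b := fun hm => hm.2.not_gt hz
    have h1 := hr₃ z hzI
    have h2 := hDz z hzI
    simp only [eval_sub, eval_mul, eval_C] at h1 ⊢
    linear_combination -h1 + D.eval z * h2
  have hzI : b + 1 ∉ Icc a b := fun hm => by linarith [hm.2]
  have hpos := h.integral_pos (continuousOn_div_sub hDc hzI) (fun t ht =>
    div_nonneg (by rw [eval_mul, mul_one]; exact mul_self_nonneg _) (by linarith [ht.2]))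
    D.roots.toFinset fun t ht h0 => by
      rw [div_eq_zero_iff, or_iff_left (sub_ne_zero_of_notMem hzI ht)] at h0
      simpa [hD0] using h0
  have h1 := hr₃ _ hzI
  have h2 := hDz _ hzI
  have h3 := congrArg (eval (b + 1)) hz0
  simp only [eval_sub, eval_mul, eval_C, eval_zero] at h1 h3
  have h4 : cau μ (fun t => (D * D).eval t * 1) (b + 1) = 0 := by
    simp only [eval_mul]
    linear_combination -h1 + D.eval (b + 1) * h2 + h3
  exact hpos.ne' h4

end Good

namespace Good

variable {μ τ τ' : Measure ℝ} {a' b' a b : ℝ}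

/-- The inverse of `A + cau μ ψ` when `A ≠ 0`. -/
theorem exists_inverse (h : Good μ a b) {ψ : ℝ → ℝ} (hψ : NZ ψ a b) {A : ℝ} (hA : A ≠ 0)
    (hne : ∀ z ∉ Icc a b, A + cau μ ψ z ≠ 0) :
    ∃ (τ : Measure ℝ) (η : ℝ), Good τ a b ∧ η ≠ 0 ∧ ∀ z ∉ Icc a b,
      1 / (A + cau μ ψ z) = 1 / A + η * cau τ (fun _ => 1) z := by
  obtain ⟨ε, hε, hψε⟩ := hψ.abs_eq
  have hcau : ∀ z, cau μ ψ z =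
      ε * cau (μ.withDensity fun t => ENNReal.ofReal |ψ t|) (fun _ => 1) z := fun z => by
    rw [cau, cau, h.integral_withDensity hψ.1, ← integral_const_mul]
    refine h.integral_congr fun t ht => ?_
    rw [mul_one_div, ← mul_div_assoc, ← hψε t ht]
  obtain ⟨τ, hτ, hτz⟩ := (h.withDensity hψ).exists_inverse_one (div_ne_zero hA hε) fun z hz h0 =>
    hne z hz (by rw [hcau, ← mul_div_cancel₀ A hε, ← mul_add, h0, mul_zero])
  refine ⟨τ, -(ε / A ^ 2), hτ, neg_ne_zero.2 (by positivity), fun z hz => ?_⟩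
  have h1 := hτz z hz
  have h2 := hne z hz
  rw [hcau] at h2 ⊢
  have h3 : A / ε + cau (μ.withDensity fun t => ENNReal.ofReal |ψ t|) (fun _ => 1) z ≠ 0 := by
    intro h0
    refine h2 ?_
    rw [← mul_div_cancel₀ A hε, ← mul_add, h0, mul_zero]
  rw [← mul_div_cancel₀ A hε, ← mul_add, mul_div_cancel₀ A hε, ← one_div_mul_one_div, h1]
  field_simp
  ring

theorem cau_sub_mul (h : Good μ a b) {φ : ℝ → ℝ} (hφ : ContinuousOn φ (Icc a b)) (c : ℝ) {z : ℝ}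
    (hz : z ∉ Icc a b) :
    (z - c) * cau μ φ z = ∫ t, φ t ∂μ + cau μ (fun t => (t - c) * φ t) z := by
  have h1 := h.mul_cau hφ hz
  have h2 := h.cau_sub (φ := fun t => t * φ t) (ψ := fun t => c * φ t) (by fun_prop) (by fun_prop) hz
  rw [cau_const_mul] at h2
  simp only [sub_mul]
  rw [h2, h1]
  ring

/-- The inverse of `cau μ ψ`. -/
theorem exists_inverse_cau (h : Good μ a b) {ψ : ℝ → ℝ} (hψ : NZ ψ a b) :
    ∃ (τ : Measure ℝ) (B Γ η : ℝ), Good τ a b ∧ Γ ≠ 0 ∧ η ≠ 0 ∧ ∀ z ∉ Icc a b,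
      1 / cau μ ψ z = B + Γ * z + η * cau τ (fun _ => 1) z := by
  have hA := h.integral_ne_zero hψ
  have hza : ∀ z ∉ Icc a b, z - a ≠ 0 := fun z hz => sub_ne_zero_of_notMem hz ⟨le_rfl, h.le⟩
  have hψc := hψ.1
  obtain ⟨ε, hε, hψε⟩ := hψ.abs_eq
  have hga : ContinuousOn (fun t => (t - a) * ψ t) (Icc a b) := by fun_prop
  have hz : ∀ t ∈ Icc a b, (t - a) * ψ t = 0 → t ∈ ({a} : Finset ℝ) := fun t ht h0 => by
    simpa [sub_eq_zero] using (mul_eq_zero.1 h0).resolve_right (hψ.2 t ht)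
  have hG := h.withDensity_of_zeros hga hz
  set ρ := μ.withDensity fun t => ENNReal.ofReal |(t - a) * ψ t| with hρ
  have hcau : ∀ z ∉ Icc a b, (z - a) * cau μ ψ z =
      ε * ((∫ t, ψ t ∂μ) / ε + cau ρ (fun _ => 1) z) := fun z hz => by
    rw [h.cau_sub_mul hψ.1 a hz, mul_add, mul_div_cancel₀ _ hε, cau, cau,
      h.integral_withDensity hga, ← integral_const_mul]
    congr 1
    refine h.integral_congr fun t ht => ?_
    rw [abs_mul, abs_of_nonneg (sub_nonneg.2 ht.1), mul_one_div, ← mul_div_assoc, mul_left_comm,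
      ← hψε t ht]
  obtain ⟨τ, hτ, hτz⟩ := hG.exists_inverse_one (div_ne_zero hA hε) fun z hz h0 => by
    have := hcau z hz
    rw [h0, mul_zero] at this
    exact mul_ne_zero (hza z hz) (h.cau_ne_zero hψ hz) this
  have hta : ∀ t ∈ Icc a b, t - a = 0 → t ∈ ({a} : Finset ℝ) := fun t _ h0 => by
    simpa [sub_eq_zero] using h0
  have hca : ContinuousOn (fun t => t - a) (Icc a b) := by fun_prop
  set A := ∫ t, ψ t ∂μ with hAdef
  refine ⟨τ.withDensity fun t => ENNReal.ofReal |t - a|, -(a / A) - ε / A ^ 2 * ∫ _, (1 : ℝ) ∂τ,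
    1 / A, -(ε / A ^ 2), hτ.withDensity_of_zeros hca hta, one_div_ne_zero hA,
    neg_ne_zero.2 (by positivity), fun z hz => ?_⟩
  have h1 : cau (τ.withDensity fun t => ENNReal.ofReal |t - a|) (fun _ => 1) z =
      (z - a) * cau τ (fun _ => 1) z - ∫ _, (1 : ℝ) ∂τ := by
    rw [hτ.cau_sub_mul continuousOn_const a hz, add_sub_cancel_left, cau, cau,
      hτ.integral_withDensity hca]
    refine hτ.integral_congr fun t ht => ?_
    rw [abs_of_nonneg (sub_nonneg.2 ht.1), mul_one_div, mul_one]
  have h2 := hτz z hz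
  have h3 := hcau z hz
  have h4 := hza z hz
  have h5 := h.cau_ne_zero hψ hz
  rw [h1]
  have h6 : A / ε + cau ρ (fun _ => 1) z = (z - a) * cau μ ψ z / ε := by
    rw [h3]; field_simp
  rw [h6] at h2
  have h7 : 1 / cau μ ψ z = (z - a) / ε * (1 / ((z - a) * cau μ ψ z / ε)) := by field_simp
  rw [h7, h2]
  field_simp
  ring

theorem integral_mul_cau_swap (h : Good μ a b) (h' : Good τ' a' b')
    (hd : Disjoint (Icc a b) (Icc a' b')) {f g : ℝ → ℝ} (hf : ContinuousOn f (Icc a b))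
    (hg : ContinuousOn g (Icc a' b')) :
    ∫ u, f u * cau τ' g u ∂μ = -∫ s, g s * cau μ f s ∂τ' := by
  have := h.finite
  have := h'.finite
  have hF : Integrable (Function.uncurry fun u s => f u * (g s / (u - s))) (μ.prod τ') := by
    rw [← h.restrict, ← h'.restrict, Measure.prod_restrict]
    refine ContinuousOn.integrableOn_compact (isCompact_Icc.prod isCompact_Icc) ?_
    refine (hf.comp continuousOn_fst fun x hx => hx.1).mul
      ((hg.comp continuousOn_snd fun x hx => hx.2).div (by fun_prop) fun x hx h0 => ?_)
    exact hd.ne_of_mem hx.1 hx.2 (sub_eq_zero.1 h0)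
  simp only [cau, ← integral_const_mul]
  rw [integral_integral_swap hF, ← integral_neg]
  refine integral_congr_ae (Eventually.of_forall fun s => ?_)
  simp only [← integral_neg]
  refine integral_congr_ae (Eventually.of_forall fun u => ?_)
  simp only
  rw [← neg_sub s u, div_neg]
  ring

/-- Division of an iterated Cauchy transform by `A + cau μ ψ`. -/
theorem cau_mul_cau_div (h : Good μ a b) {ψ R : ℝ → ℝ} (hψ : ContinuousOn ψ (Icc a b))
    {A B Γ η : ℝ} (hR : ∀ z, R z = A + cau μ ψ z)
    (hne : ∀ z ∉ Icc a b, R z ≠ 0) (hτ : Good τ a b)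
    (hG : ∀ z ∉ Icc a b, 1 / R z = B + Γ * z + η * cau τ (fun _ => 1) z) (h' : Good τ' a' b')
    (hd : Disjoint (Icc a b) (Icc a' b')) {χ : ℝ → ℝ} (hχ : ContinuousOn χ (Icc a' b')) {z : ℝ}
    (hz : z ∉ Icc a b) :
    cau μ (fun t => ψ t * cau τ' χ t) z / R z =
      -Γ * ∫ s, χ s * R s ∂τ' + cau τ (fun t => -η * cau τ' (fun s => χ s * R s) t) z := by
  have hRc : ContinuousOn R (Icc a b)ᶜ := by
    rw [funext hR]; exact continuousOn_const.add (h.continuousOn_cau hψ)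
  have h1c : ContinuousOn (fun t => 1 / (z - t)) (Icc a b) :=
    continuousOn_div_sub continuousOn_const hz
  have hψz := continuousOn_div_sub hψ hz
  have key₀ : ∀ s ∉ Icc a b, s ≠ z → -cau μ (fun u => ψ u / (z - u)) s =
      R z * R s * (-Γ + η * cau τ (fun t => 1 / (z - t)) s) := by
    intro s hs hsz
    have hzs : z - s ≠ 0 := sub_ne_zero.2 hsz.symm
    have e1 : ∀ {ν : Measure ℝ} {φ : ℝ → ℝ}, Good ν a b → ContinuousOn φ (Icc a b) →
        (z - s) * cau ν (fun u => φ u / (z - u)) s = cau ν φ s - cau ν φ z := by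
      intro ν φ hν hφ
      unfold cau
      rw [← integral_sub (hν.integrable_cau hφ hs) (hν.integrable_cau hφ hz),
        ← integral_const_mul]
      refine hν.integral_congr fun t ht => ?_
      have h1 := sub_ne_zero_of_notMem hs ht
      have h2 := sub_ne_zero_of_notMem hz ht
      field_simp
      ring
    have h1 := e1 h hψ
    have h2 := e1 hτ (continuousOn_const (c := (1 : ℝ)))
    have h3 := hG s hs
    have h4 := hG z hz
    have h5 := hne s hs
    have h6 := hne z hz
    have h7 := hR s
    have h8 := hR z
    have h9 : R z - R s = R z * R s * (1 / R s - 1 / R z) := by field_simp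
    refine mul_left_cancel₀ hzs ?_
    rw [h3, h4] at h9
    linear_combination -h1 + h7 - h8 + h9 - R z * R s * η * h2
  have key : ∀ s ∉ Icc a b, -cau μ (fun u => ψ u / (z - u)) s =
      R z * R s * (-Γ + η * cau τ (fun t => 1 / (z - t)) s) := by
    intro s hs
    by_cases hsz : s = z
    · subst hsz
      have hnhds : (Icc a b)ᶜ ∈ nhds s := isClosed_Icc.isOpen_compl.mem_nhds hs
      have c1 : ContinuousAt (fun s' => -cau μ (fun u => ψ u / (s - u)) s') s :=
        ((h.continuousOn_cau hψz).continuousAt hnhds).neg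
      have c2 : ContinuousAt
          (fun s' => R s * R s' * (-Γ + η * cau τ (fun t => 1 / (s - t)) s')) s := by
        have d1 := hRc.continuousAt hnhds
        have d2 := (hτ.continuousOn_cau h1c).continuousAt hnhds
        fun_prop
      refine tendsto_nhds_unique (c1.mono_left nhdsWithin_le_nhds)
        ((c2.mono_left (nhdsWithin_le_nhds (s := {s}ᶜ))).congr' ?_)
      filter_upwards [nhdsWithin_le_nhds hnhds, self_mem_nhdsWithin] with s' hs' hne'
      exact (key₀ s' hs' hne').symm
    · exact key₀ s hs hsz
  have hχR : ContinuousOn (fun s => χ s * R s) (Icc a' b') :=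
    hχ.mul (hRc.mono hd.subset_compl_left)
  have l1 : cau μ (fun t => ψ t * cau τ' χ t) z =
      ∫ s, χ s * -cau μ (fun u => ψ u / (z - u)) s ∂τ' := by
    simp only [mul_neg]
    rw [integral_neg, ← h.integral_mul_cau_swap h' hd hψz hχ, cau]
    simp only [div_mul_eq_mul_div]
  have l2 : cau τ (fun t => -η * cau τ' (fun s => χ s * R s) t) z =
      η * ∫ s, χ s * R s * cau τ (fun t => 1 / (z - t)) s ∂τ' := by
    have := hτ.integral_mul_cau_swap h' hd h1c hχR
    rw [cau_const_mul, cau]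
    simp only [one_div_mul_eq_div] at this
    rw [this]
    ring
  have hc3 := hτ.continuousOn_cau h1c |>.mono hd.subset_compl_left
  rw [l1, l2, ← integral_const_mul, ← integral_const_mul, ← integral_add (h'.integrable (by fun_prop))
    (h'.integrable (by fun_prop)), ← integral_div]
  refine h'.integral_congr fun s hs => ?_
  rw [key s (hd.subset_compl_left hs)]
  have := hne z hz
  field_simp

end Good

theorem NZ.congr {f g : ℝ → ℝ} {a b : ℝ} (hf : NZ f a b) (h : ∀ x ∈ Icc a b, g x = f x) :
    NZ g a b :=
  ⟨hf.1.congr h, fun x hx => by rw [h x hx]; exact hf.2 x hx⟩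

/-- A chain can be reordered so that a given index comes first. -/
theorem SChain.wChain_erase {k : ℕ} : ∀ {l : List ℕ} {a b : ℝ} {f : ℕ → ℝ → ℝ}, l.Nodup → 0 ∉ l →
    k ∈ l → SChain l a b f → WChain (k :: l.erase k) a b f
  | [], _, _, _, _, _, hk, _ => absurd hk (by simp)
  | j :: l, a, b, f, hnd, h0, hk, h => by
    rw [List.nodup_cons] at hnd
    rw [List.mem_cons, not_or] at h0
    by_cases hkj : k = j
    · subst hkj
      simpa using h.wChain
    have hkl : k ∈ l := by simpa [hkj] using hk
    rw [List.erase_cons_tail (by simpa using Ne.symm hkj)]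
    obtain ⟨a', b', μ, A, α, φ, hμ, hd, hfj, hφc, hf, hl, hS⟩ := h
    obtain ⟨a₁, b₁, ν, A', α', χ, hν, hd', hφk, hχc, hφ, hα', hW⟩ :=
      hS.wChain_erase hnd.2 h0.2 hkl
    obtain ⟨hαk, hAk, -, hRk⟩ := hl k hkl
    obtain ⟨τ, η, hτ, hη, hG⟩ := hμ.exists_inverse hφk hAk hRk
    set R : ℝ → ℝ := fun z => A k + cau μ (φ k) z with hR
    have hRc : ContinuousOn R (Icc a' b')ᶜ := continuousOn_const.add (hμ.continuousOn_cau hφk.1)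
    have hR₁ : NZ R a₁ b₁ := ⟨hRc.mono hd'.subset_compl_left, fun z hz =>
      hRk z (hd'.subset_compl_left hz)⟩
    have hfk : ∀ x ∈ Icc a b, f k x = f j x * R x := fun x hx => by
      rw [hf k (List.mem_cons_of_mem _ hkl) x hx, hαk, zero_mul, add_zero]
    have hRab : NZ R a b := ⟨hRc.mono hd.subset_compl_right, fun z hz =>
      hRk z (hd.subset_compl_right hz)⟩
    have hmem : ∀ i ∈ 0 :: l.erase k, i ∈ 0 :: l ∧ i ≠ j := fun i hi => by
      rcases List.mem_cons.1 hi with rfl | hi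
      · exact ⟨by simp, h0.1⟩
      · have := List.mem_of_mem_erase hi
        exact ⟨List.mem_cons_of_mem _ this, fun h => hnd.1 (h ▸ this)⟩
    set c₁ : ℕ → ℝ := fun i => A i - A' i * A k - α' i * ∫ t, φ k t ∂μ with hc₁
    set c₂ : ℕ → ℝ := fun i => α i - α' i * A k with hc₂
    set κ : ℕ → ℝ → ℝ := fun i t => if i = j then η else
      η * (c₁ i + c₂ i * t + cau ν (fun s => -R s * χ i s) t) with hκ
    have hκj : κ j = fun _ => η := by simp [hκ]
    have hκi : ∀ i ∈ 0 :: l.erase k, κ i = fun t =>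
        η * (c₁ i + c₂ i * t + cau ν (fun s => -R s * χ i s) t) := fun i hi => by
      simp [hκ, (hmem i hi).2]
    have hRχ : ∀ i ∈ 0 :: l.erase k, ContinuousOn (fun s => -R s * χ i s) (Icc a₁ b₁) :=
      fun i hi => hR₁.1.neg.mul (hχc i hi)
    have hκc : ∀ i ∈ 0 :: l.erase k, ContinuousOn (κ i) (Icc a' b') := fun i hi => by
      have := hν.continuousOn_cau_Icc (hRχ i hi) hd'
      rw [hκi i hi]
      fun_prop
    have hc₂0 : ∀ i ∈ l.erase k, c₂ i = 0 := fun i hi => by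
      simp [hc₂, hα' i hi, (hl i (List.mem_of_mem_erase hi)).1]
    have hsplit : ∀ i ∈ 0 :: j :: l.erase k, i = j ∨ i ∈ 0 :: l.erase k := fun i hi => by
      simp at hi ⊢; tauto
    refine ⟨a', b', τ, fun i => if i = j then 1 / A k else
        A' i + c₁ i * (1 / A k) + c₂ i * η * ∫ _, (1 : ℝ) ∂τ,
      fun i => if i = j then 0 else α' i + c₂ i * (1 / A k), κ, hτ, hd,
      (hfj.mul hRab).congr hfk, fun i hi => ?_, fun i hi x hx => ?_, fun i hi => ?_, ?_⟩
    · rcases hsplit i hi with rfl | hi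
      · rw [hκj]; exact continuousOn_const
      · exact hκc i hi
    · have hx' : x ∉ Icc a' b' := hd.subset_compl_right hx
      have hRx := hRk x hx'
      have hGx : 1 / R x = 1 / A k + η * cau τ (fun _ => 1) x := hG x hx'
      rw [hfk x hx]
      rcases hsplit i hi with rfl | hi
      · rw [hκj]
        simp only [if_true]
        have e1 := Good.cau_const_mul (μ := τ) η (fun _ => 1) x
        simp only [mul_one] at e1
        rw [e1, zero_mul, add_zero, ← hGx]
        change R x ≠ 0 at hRx
        field_simp
      · have hij := (hmem i hi).2
        simp only [if_neg hij]
        rw [hf i (hmem i hi).1 x hx, mul_assoc]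
        congr 1
        have hχi := hχc i hi
        have hcν := hν.continuousOn_cau_Icc hχi hd'
        have hcν' := hν.continuousOn_cau_Icc (hRχ i hi) hd'
        have hφkc := hφk.1
        have e1 : cau μ (φ i) x = A' i * cau μ (φ k) x + α' i * (x * cau μ (φ k) x - ∫ t, φ k t ∂μ) +
            cau μ (fun t => φ k t * cau ν (χ i) t) x := by
          rw [hμ.mul_cau hφk.1 hx', add_sub_cancel_left, ← Good.cau_const_mul, ← Good.cau_const_mul,
            ← hμ.cau_add (by fun_prop) (by fun_prop) hx',
            ← hμ.cau_add (by fun_prop) (by fun_prop) hx']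
          refine hμ.cau_congr (fun t ht => ?_) x
          rw [hφ i hi t ht]
          ring
        have e2 := Good.cau_mul_cau_div (R := R) (A := A k) (B := 1 / A k) (Γ := 0) (η := η) hμ
          hφk.1 (fun _ => rfl) hRk hτ (fun z hz => by rw [zero_mul, add_zero]; exact hG z hz)
          hν hd' hχi hx'
        have e3 : cau τ (κ i) x = η * c₁ i * cau τ (fun _ => 1) x +
            η * c₂ i * (x * cau τ (fun _ => 1) x - ∫ _, (1 : ℝ) ∂τ) +
            cau τ (fun t => -η * cau ν (fun s => χ i s * R s) t) x := by
          have hneg : ∀ t, cau ν (fun s => -R s * χ i s) t = -1 * cau ν (fun s => χ i s * R s) t :=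
            fun t => by
              rw [← Good.cau_const_mul]
              congr 1
              funext s
              ring
          have hcν'' : ContinuousOn (cau ν fun s => χ i s * R s) (Icc a' b') :=
            hν.continuousOn_cau_Icc (hχi.mul hR₁.1) hd'
          rw [hτ.mul_cau continuousOn_const hx', add_sub_cancel_left, ← Good.cau_const_mul,
            ← Good.cau_const_mul, ← hτ.cau_add (by fun_prop) (by fun_prop) hx',
            ← hτ.cau_add (by fun_prop) (by fun_prop) hx', hκi i hi]
          refine hτ.cau_congr (fun t ht => ?_) x
          rw [hneg]
          ring
        rw [e3]
        have e4 : cau μ (φ k) x = R x - A k := by simp [hR]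
        rw [e4] at e1
        rw [e1]
        rw [neg_zero, zero_mul, zero_add] at e2
        rw [← e2]
        change R x ≠ 0 at hRx
        have e5 : η * cau τ (fun _ => 1) x = 1 / R x - 1 / A k := by rw [hGx]; ring
        have e6 : η * c₁ i * cau τ (fun _ => 1) x +
            η * c₂ i * (x * cau τ (fun _ => 1) x - ∫ _, (1 : ℝ) ∂τ) =
            (c₁ i + c₂ i * x) * (1 / R x - 1 / A k) - c₂ i * η * ∫ _, (1 : ℝ) ∂τ := by
          rw [← e5]; ring
        rw [e6]
        simp only [hc₁, hc₂]
        field_simp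
        ring
    · rcases List.mem_cons.1 hi with rfl | hi
      · simp
      · have := (hmem i (List.mem_cons_of_mem _ hi)).2
        simp [this, hα' i hi, hc₂0 i hi]
    · refine ⟨a₁, b₁, ν, c₁, c₂, fun i s => -R s * χ i s, hν, hd', ?_, hRχ, fun i hi t ht => ?_,
        hc₂0, hW.congr_mul hR₁.neg fun i _ x _ => rfl⟩
      · rw [hκj]; exact NZ.const hη
      · rw [hκi i hi, hκj]

theorem NChain.sChain : ∀ {l : List ℕ} {a b : ℝ} {f : ℕ → ℝ → ℝ}, l.Nodup → 0 ∉ l →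
    NChain l 0 a b f → SChain l a b f
  | [], _, _, _, _, _, h => h
  | [j], a, b, f, _, h0, ⟨a', b', μ, φ, hμ, hd, hf0, hf, _⟩ => by
    obtain ⟨τ, B, Γ, η, hτ, -, hη, hG⟩ := hμ.exists_inverse_cau (hf j (by simp)).1
    have hcab := hμ.nz_cau (hf j (by simp)).1 hd
    refine ⟨a', b', τ, fun _ => B, fun _ => Γ, fun _ _ => η, hτ, hd,
      (hf0.mul hcab).congr (hf j (by simp)).2, fun i _ => continuousOn_const, fun i hi x hx => ?_,
      by simp, NZ.const hη⟩
    obtain rfl : i = 0 := by simpa using hi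
    have e1 := Good.cau_const_mul (μ := τ) η (fun _ => 1) x
    simp only [mul_one] at e1
    rw [e1, ← hG x (hd.subset_compl_right hx), (hf j (by simp)).2 x hx]
    have := hcab.2 x hx
    field_simp
  | j :: j' :: l, a, b, f, hnd, h0,
      ⟨a', b', μ, φ, hμ, hd, hf0, hf, a₁, b₁, ν, χ, hν, hd', hφj, hφ, hN⟩ => by
    obtain ⟨τ, B, Γ, η, hτ, hΓ, hη, hG⟩ := hμ.exists_inverse_cau hφj
    rw [List.nodup_cons] at hnd
    rw [List.mem_cons, not_or] at h0
    have hfj := hf j (by simp)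
    set R : ℝ → ℝ := cau μ (φ j) with hR
    have hcab : NZ R a b := hμ.nz_cau hφj hd
    have hR₁ : NZ R a₁ b₁ := hμ.nz_cau hφj hd'.symm
    have hRk : ∀ z ∉ Icc a' b', R z ≠ 0 := fun z hz => hμ.cau_ne_zero hφj hz
    have hi0 : ∀ i ∈ j' :: l, i ≠ 0 := fun i hi h => h0.2 (h ▸ hi)
    set κ : ℕ → ℝ → ℝ := fun i t => if i = 0 then η else -η * cau ν (fun s => χ i s * R s) t with hκ
    have hκ0 : κ 0 = fun _ => η := by simp [hκ]
    have hκi : ∀ i ∈ j' :: l, κ i = fun t => -η * cau ν (fun s => χ i s * R s) t := fun i hi => by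
      simp [hκ, hi0 i hi]
    have hχR : ∀ i ∈ j' :: l, NZ (fun s => χ i s * R s) a₁ b₁ := fun i hi => (hφ i hi).1.mul hR₁
    have hκn : ∀ i ∈ j' :: l, NZ (κ i) a' b' := fun i hi => by
      rw [hκi i hi]
      exact (hν.nz_cau (hχR i hi) hd').const_mul (neg_ne_zero.2 hη)
    have hκ0n : NZ (κ 0) a' b' := by rw [hκ0]; exact NZ.const hη
    have hratio : ∀ i ∈ j' :: l, ∀ z ∉ Icc a' b', cau μ (φ i) z / R z =
        -Γ * ∫ s, χ i s * R s ∂ν + cau τ (κ i) z := fun i hi z hz => by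
      have := Good.cau_mul_cau_div (R := R) (A := 0) hμ hφj.1 (fun z => by simp [hR]) hRk hτ hG hν
        hd' (hφ i hi).1.1 hz
      rw [hκi i hi, ← this, hμ.cau_congr (hφ i hi).2]
    refine ⟨a', b', τ, fun i => if i = 0 then B else -Γ * ∫ s, χ i s * R s ∂ν,
      fun i => if i = 0 then Γ else 0, κ, hτ, hd, (hf0.mul hcab).congr hfj.2, fun i hi => ?_,
      fun i hi x hx => ?_, fun i hi => ⟨if_neg (hi0 i hi), ?_, hκn i hi, fun z hz => ?_⟩, ?_⟩
    · rcases List.mem_cons.1 hi with rfl | hi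
      · exact hκ0n.1
      · exact (hκn i hi).1
    · have hx' : x ∉ Icc a' b' := hd.subset_compl_right hx
      have hRx := hRk x hx'
      rw [hfj.2 x hx]
      rcases List.mem_cons.1 hi with rfl | hi
      · have e1 := Good.cau_const_mul (μ := τ) η (fun _ => 1) x
        simp only [mul_one] at e1
        simp only [if_true, hκ0]
        rw [e1, ← hG x hx']
        field_simp
      · simp only [if_neg (hi0 i hi)]
        rw [zero_mul, add_zero, ← hratio i hi x hx', (hf i (List.mem_cons_of_mem _ hi)).2 x hx]
        field_simp
    · simp only [if_neg (hi0 i hi)]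
      exact mul_ne_zero (neg_ne_zero.2 hΓ) (hν.integral_ne_zero (hχR i hi))
    · simp only [if_neg (hi0 i hi)]
      rw [← hratio i hi z hz]
      exact div_ne_zero (hμ.cau_ne_zero (hf i (List.mem_cons_of_mem _ hi)).1 hz) (hRk z hz)
    · refine NChain.sChain hnd.2 h0.2 ⟨a₁, b₁, ν, fun i s => -R s * χ i s, hν, hd', hκ0n,
        fun i hi => ⟨hR₁.neg.mul (hφ i hi).1, fun t ht => ?_⟩,
        hN.congr_mul hR₁.neg fun i _ x _ => rfl⟩
      rw [hκi i hi, hκ0]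
      simp only
      rw [neg_mul, ← mul_neg, ← neg_one_mul, ← Good.cau_const_mul]
      congr 2
      funext s
      ring

theorem NChain.card_le_range {m n k : ℕ} {a b ξ : ℝ} {f : ℕ → ℝ → ℝ}
    (h : NChain (List.range' 1 m) 0 a b f) (hk : k ≤ m) (hξ : ξ ∈ Icc a b) {c : ℝ} {p : ℕ → ℝ[X]}
    (hp0 : (p 0).degree < n) (hp : ∀ i ∈ List.range' 1 m, (p i).degree < (n + 1 : ℕ))
    (hne : c ≠ 0 ∨ ∃ i < m + 1, p i ≠ 0) (Z : Finset ℝ) (hZ : ∀ z ∈ Z, z ∈ Icc a b)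
    (hz : ∀ z ∈ Z, c * f k z +
      (z - ξ) * ∑ i ∈ Finset.range (m + 1), (p i).eval z * f i z = 0) :
    Z.card ≤ m * (n + 1) + n := by
  have hrange : List.range (m + 1) = 0 :: List.range' 1 m := List.range_eq_range'
  have hsum : ∀ z, ∑ i ∈ Finset.range (m + 1), (p i).eval z * f i z =
      lform p f (0 :: List.range' 1 m) z := fun z => by rw [← hrange, lform_range]
  have hmem : ∀ i < m + 1, i ∈ 0 :: List.range' 1 m := fun i hi => by
    rw [← hrange]; exact List.mem_range.2 hi
  replace hne := hne.imp_right fun ⟨i, hi, hpi⟩ => (⟨i, hmem i hi, hpi⟩ :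
    ∃ i ∈ 0 :: List.range' 1 m, p i ≠ 0)
  simp only [hsum] at hz
  rcases List.mem_cons.1 (hmem k (Nat.lt_succ_of_le hk)) with rfl | hkl
  · simpa using h.card_le hξ hp hp0 hne Z hZ hz
  · have h0 : 0 ∉ List.range' 1 m := by simp
    have hperm := List.perm_cons_erase hkl
    have hW := (h.sChain List.nodup_range' h0).wChain_erase List.nodup_range' h0 hkl
    have := hW.card_le hξ (fun i hi => hp i (hperm.mem_iff.2 hi)) hp0
      (hne.imp_right fun ⟨i, hi, hpi⟩ => ⟨i, (hperm.cons 0).mem_iff.1 hi, hpi⟩) Z hZ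
      fun z hzZ => by rw [lform_perm p f (hperm.cons 0).symm]; exact hz z hzZ
    rwa [← hperm.length_eq, List.length_range'] at this

namespace Good

variable {ν : Measure ℝ} {a b : ℝ}

theorem poly_eq_zero_of_tendsto (h : Good ν a b) {φ : ℝ → ℝ} (hφ : ContinuousOn φ (Icc a b))
    {D : ℝ[X]} {d : ℕ} (hD : Tendsto (fun z => z ^ d * (D.eval z + cau ν φ z)) atTop (nhds 0)) :
    D = 0 := by
  have h1 : Tendsto (fun z : ℝ => (z ^ d)⁻¹ * (z ^ d * (D.eval z + cau ν φ z))) atTop (nhds 0) := by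
    refine squeeze_zero_norm' ?_ (tendsto_zero_iff_norm_tendsto_zero.1 hD)
    filter_upwards [eventually_ge_atTop 1] with z hz
    rw [norm_mul]
    refine mul_le_of_le_one_left (norm_nonneg _) ?_
    rw [norm_inv, Real.norm_of_nonneg (by positivity)]
    exact inv_le_one_of_one_le₀ (one_le_pow₀ hz)
  have h2 : Tendsto (fun z => D.eval z) atTop (nhds 0) := by
    have := h1.sub (h.tendsto_cau hφ)
    rw [sub_zero] at this
    refine this.congr' ?_
    filter_upwards [eventually_gt_atTop 0] with z hz
    field_simp
    ring
  exact leadingCoeff_eq_zero.1 (D.tendsto_nhds_iff.1 h2).1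

theorem integral_pow_mul_eq_zero (h : Good ν a b) : ∀ (d : ℕ) {φ : ℝ → ℝ}
    (_ : ContinuousOn φ (Icc a b)) (_ : Tendsto (fun z => z ^ d * cau ν φ z) atTop (nhds 0)),
    ∀ j < d, ∫ t, t ^ j * φ t ∂ν = 0
  | 0, _, _, _ => by simp
  | d + 1, φ, hφ, hd => by
    have h1 : Tendsto (fun z => z ^ d * ((C (∫ t, φ t ∂ν)).eval z + cau ν (fun t => t * φ t) z))
        atTop (nhds 0) := by
      refine hd.congr' ?_
      filter_upwards [eventually_gt_atTop b] with z hz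
      rw [eval_C, ← h.mul_cau hφ fun hm => hm.2.not_gt hz]
      ring
    have h2 := C_eq_zero.1 (h.poly_eq_zero_of_tendsto (by fun_prop) h1)
    simp only [h2, C_0, eval_zero, zero_add] at h1
    rintro (_ | j) hj
    · simpa using h2
    · simpa only [pow_succ, mul_assoc] using
        h.integral_pow_mul_eq_zero d (by fun_prop) h1 j (Nat.lt_of_succ_lt_succ hj)

/-- The associated polynomial and the orthogonality relations of a Padé-type approximation. -/
theorem eval_eq_integral_of_tendsto (h : Good ν a b) {φ : ℝ → ℝ} (hφ : ContinuousOn φ (Icc a b))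
    {q P : ℝ[X]} {ξ : ℝ} {d : ℕ}
    (hd : Tendsto (fun z => z ^ d * (((X - C ξ) * q).eval z * cau ν φ z - P.eval z))
      atTop (nhds 0)) :
    P.eval ξ = ∫ t, q.eval t * φ t ∂ν ∧ ∀ p : ℝ[X], p.degree < (d : WithBot ℕ) →
      ∫ t, q.eval t * ((t - ξ) * (p.eval t * φ t)) ∂ν = 0 := by
  obtain ⟨r, -, hr⟩ := h.exists_polyPart q.natDegree (p := q)
    (degree_le_natDegree.trans_lt (by exact_mod_cast Nat.lt_succ_self _)) hφ
  have h1 : Tendsto (fun z => z ^ d * (((X - C ξ) * r + C (∫ t, q.eval t * φ t ∂ν) - P).eval z +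
      cau ν (fun t => (t - ξ) * (q.eval t * φ t)) z)) atTop (nhds 0) := by
    refine hd.congr' ?_
    filter_upwards [eventually_gt_atTop b] with z hz
    have hz' : z ∉ Icc a b := fun hm => hm.2.not_gt hz
    have e1 := h.cau_sub_mul (φ := fun t => q.eval t * φ t) (by fun_prop) ξ hz'
    have e2 := hr z hz'
    simp only [eval_sub, eval_add, eval_mul, eval_X, eval_C]
    linear_combination z ^ d * (z - ξ) * e2 + z ^ d * e1
  have h2 := h.poly_eq_zero_of_tendsto (by fun_prop) h1
  rw [h2] at h1
  simp only [eval_zero, zero_add] at h1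
  refine ⟨?_, fun p hp => ?_⟩
  · rw [← sub_eq_zero.1 h2]
    simp
  · have h3 := h.integral_pow_mul_eq_zero d (by fun_prop) h1
    have h4 : ∀ t, p.eval t = ∑ j ∈ Finset.range d, p.coeff j * t ^ j := fun t => by
      rcases eq_or_ne p 0 with rfl | hp0
      · simp
      · exact eval_eq_sum_range' ((natDegree_lt_iff_degree_lt hp0).2 hp) t
    calc ∫ t, q.eval t * ((t - ξ) * (p.eval t * φ t)) ∂ν
        = ∫ t, ∑ j ∈ Finset.range d,
            p.coeff j * (t ^ j * ((t - ξ) * (q.eval t * φ t))) ∂ν := by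
          refine integral_congr_ae (Eventually.of_forall fun t => ?_)
          simp only [h4, Finset.sum_mul, Finset.mul_sum]
          exact Finset.sum_congr rfl fun j _ => by ring
      _ = 0 := by
          rw [integral_finsetSum _ fun j _ => h.integrable (by fun_prop)]
          exact Finset.sum_eq_zero fun j hj => by
            rw [integral_const_mul, h3 j (Finset.mem_range.1 hj), mul_zero]

end Good

theorem good_of_msupport {ν : Measure ℝ} [IsFiniteMeasure ν]
    (hc : IsCompact (SignedM.msupport ν)) (hi : (SignedM.msupport ν).Infinite) :
    Good ν (sInf (SignedM.msupport ν)) (sSup (SignedM.msupport ν)) := by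
  refine ⟨inferInstance, ?_, fun S hS => hi (S.finite_toSet.subset fun x hx => ?_)⟩
  · refine measure_mono_null (t := (SignedM.msupport ν)ᶜ)
      (compl_subset_compl.2 hc.isBounded.subset_Icc_sInf_sSup) ?_
    refine measure_null_of_locally_null _ fun x hx => ?_
    simp only [SignedM.msupport, mem_compl_iff, mem_ofPred_eq, not_forall, not_not] at hx
    obtain ⟨U, hU, hxU, h0⟩ := hx
    exact ⟨U, mem_nhdsWithin_of_mem_nhds (hU.mem_nhds hxU), h0⟩
  · by_contra hxS
    exact hx _ S.finite_toSet.isClosed.isOpen_compl hxS hS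

/-- `s = ε ν` for a positive measure `ν` and a sign `ε`. -/
structure HasSign (s : SignedM) (ν : Measure ℝ) (ε a b : ℝ) : Prop where
  good : Good ν a b
  sign : (ε = 1 ∧ s.pos = ν ∧ s.neg = 0) ∨ (ε = -1 ∧ s.pos = 0 ∧ s.neg = ν)

theorem IsM.exists_hasSign {s : SignedM} {Δ : Set ℝ} (h : IsM s Δ) :
    ∃ (ν : Measure ℝ) (ε a b : ℝ), Δ = Icc a b ∧ HasSign s ν ε a b := by
  obtain ⟨h1, h2, h3, h4, h5, h6⟩ := h
  have h0 : SignedM.msupport 0 = ∅ := by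
    ext x
    simpa [SignedM.msupport] using ⟨univ, isOpen_univ, mem_univ x⟩
  rcases h3 with h3 | h3
  · have hs : s.supp = SignedM.msupport s.neg := by rw [SignedM.supp, h3, h0, empty_union]
    rw [hs] at h4 h5 h6
    exact ⟨s.neg, -1, _, _, h6, good_of_msupport h4 h5, Or.inr ⟨rfl, h3, rfl⟩⟩
  · have hs : s.supp = SignedM.msupport s.pos := by rw [SignedM.supp, h3, h0, union_empty]
    rw [hs] at h4 h5 h6
    exact ⟨s.pos, 1, _, _, h6, good_of_msupport h4 h5, Or.inl ⟨rfl, rfl, h3⟩⟩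

theorem Good.integral_withDensity_ofReal_sub {ν : Measure ℝ} {a b : ℝ} (h : Good ν a b)
    {g F : ℝ → ℝ} (hg : ContinuousOn g (Icc a b)) (hF : ContinuousOn F (Icc a b)) :
    ∫ t, F t ∂(ν.withDensity fun t => ENNReal.ofReal (g t)) -
      ∫ t, F t ∂(ν.withDensity fun t => ENNReal.ofReal (-g t)) = ∫ t, F t * g t ∂ν := by
  rw [integral_withDensity_eq_integral_toReal_smul₀
      (h.integrable hg).1.aemeasurable.ennreal_ofReal (by simp),
    integral_withDensity_eq_integral_toReal_smul₀
      (h.integrable (g := fun t => -g t) hg.neg).1.aemeasurable.ennreal_ofReal (by simp)]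
  simp only [ENNReal.toReal_ofReal', smul_eq_mul]
  have hgm : ContinuousOn (fun t => max (g t) 0) (Icc a b) := hg.sup continuousOn_const
  have hgm' : ContinuousOn (fun t => max (-g t) 0) (Icc a b) := hg.neg.sup continuousOn_const
  rw [← integral_sub (h.integrable (by fun_prop)) (h.integrable (by fun_prop))]
  refine h.integral_congr fun t _ => ?_
  rcases le_total 0 (g t) with h0 | h0
  · rw [max_eq_left h0, max_eq_right (neg_nonpos.2 h0)]; ring
  · rw [max_eq_right h0, max_eq_left (neg_nonneg.2 h0)]; ring

namespace HasSign

variable {s : SignedM} {ν : Measure ℝ} {ε a b : ℝ}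

theorem ne_zero (h : HasSign s ν ε a b) : ε ≠ 0 := by
  rcases h.sign with ⟨h1, -⟩ | ⟨h1, -⟩ <;> rw [h1] <;> norm_num

theorem rintegral_eq (h : HasSign s ν ε a b) (F : ℝ → ℝ) : s.rintegral F = ε * ∫ t, F t ∂ν := by
  rcases h.sign with ⟨h1, h2, h3⟩ | ⟨h1, h2, h3⟩ <;> simp [SignedM.rintegral, h1, h2, h3]

theorem rintegral_withDensityR (h : HasSign s ν ε a b) {g F : ℝ → ℝ}
    (hg : ContinuousOn g (Icc a b)) (hF : ContinuousOn F (Icc a b)) :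
    (s.withDensityR g).rintegral F = ε * ∫ t, F t * g t ∂ν := by
  have key := h.good.integral_withDensity_ofReal_sub hg hF
  rcases h.sign with ⟨h1, h2, h3⟩ | ⟨h1, h2, h3⟩ <;>
    simp only [SignedM.rintegral, SignedM.withDensityR, h1, h2, h3, ← key,
      withDensity_zero_left, zero_add, add_zero] <;>
    ring

end HasSign

theorem SignedM.cauchy_ofReal (s : SignedM) (z : ℝ) : s.cauchy z = s.cauchyR z := by
  have : ∀ μ : Measure ℝ, ∫ x, ((z : ℂ) - (x : ℂ))⁻¹ ∂μ = ((∫ x, (z - x)⁻¹ ∂μ : ℝ) : ℂ) :=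
    fun μ => by rw [← integral_complex_ofReal]; simp
  simp only [SignedM.cauchy, SignedM.cintegral, SignedM.cauchyR, SignedM.rintegral, this]
  push_cast
  rfl

/-- The density of `s_{j,k}` with respect to `σ_j`. -/
def nikDensity (σ : ℕ → SignedM) (j k : ℕ) (t : ℝ) : ℝ :=
  if j < k then (nikSys σ (j + 1) k).cauchyR t else 1

section Nikishin

variable {m : ℕ} {σ : ℕ → SignedM} {ν : ℕ → Measure ℝ} {ε a b : ℕ → ℝ}

theorem nikSys_rintegral {j k : ℕ} (h : HasSign (σ j) (ν j) (ε j) (a j) (b j)) {F : ℝ → ℝ}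
    (hg : ContinuousOn (nikDensity σ j k) (Icc (a j) (b j)))
    (hF : ContinuousOn F (Icc (a j) (b j))) :
    (nikSys σ j k).rintegral F = ε j * ∫ t, F t * nikDensity σ j k t ∂ν j := by
  rw [nikSys]
  split_ifs with hjk
  · have : nikDensity σ j k = (nikSys σ (j + 1) k).cauchyR := by
      funext t; simp [nikDensity, hjk]
    rw [this] at hg ⊢
    exact h.rintegral_withDensityR hg hF
  · simp [h.rintegral_eq, nikDensity, hjk]

theorem nikSys_cauchyR {j k : ℕ} (h : HasSign (σ j) (ν j) (ε j) (a j) (b j))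
    (hg : ContinuousOn (nikDensity σ j k) (Icc (a j) (b j))) {z : ℝ} (hz : z ∉ Icc (a j) (b j)) :
    (nikSys σ j k).cauchyR z = ε j * cau (ν j) (nikDensity σ j k) z := by
  rw [SignedM.cauchyR, nikSys_rintegral h hg]
  · simp only [cau, div_eq_inv_mul]
  · simpa using continuousOn_div_sub (continuousOn_const (c := (1 : ℝ))) hz

theorem nz_nikDensity
    (h : ∀ j ≤ m, HasSign (σ j) (ν j) (ε j) (a j) (b j))
    (hd : ∀ j, j + 1 ≤ m → Disjoint (Icc (a j) (b j)) (Icc (a (j + 1)) (b (j + 1))))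
    {k : ℕ} (hk : k ≤ m) : ∀ {r j : ℕ}, j + r = m →
    NZ (nikDensity σ j k) (a j) (b j) := by
  intro r
  induction r with
  | zero =>
    intro j hj
    have : nikDensity σ j k = fun _ => 1 := by
      funext t; simp [nikDensity, show ¬ j < k by omega]
    rw [this]
    exact NZ.const one_ne_zero
  | succ r ih =>
    intro j hj
    by_cases hjk : j < k
    · have hn := ih (j := j + 1) (by omega)
      have hs := h (j + 1) (by omega)
      have hdj := hd j (by omega)
      refine ((hs.good.nz_cau hn hdj).const_mul hs.ne_zero).congr fun x hx => ?_
      rw [nikDensity, if_pos hjk, nikSys_cauchyR hs hn.1 (hdj.subset_compl_right hx)]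
    · have : nikDensity σ j k = fun _ => 1 := by funext t; simp [nikDensity, hjk]
      rw [this]
      exact NZ.const one_ne_zero

theorem nChain_nikDensity
    (h : ∀ j ≤ m, HasSign (σ j) (ν j) (ε j) (a j) (b j))
    (hd : ∀ j, j + 1 ≤ m → Disjoint (Icc (a j) (b j)) (Icc (a (j + 1)) (b (j + 1)))) :
    ∀ {r j : ℕ}, j + r = m →
    NChain (List.range' (j + 1) r) j (a j) (b j) (nikDensity σ j) := by
  intro r
  induction r with
  | zero => exact fun {j} hj => nz_nikDensity h hd (by omega) hj
  | succ r ih =>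
    intro j hj
    have hs := h (j + 1) (by omega)
    have hdj := hd j (by omega)
    have hε := hs.ne_zero
    have hj1 : ∀ t, nikDensity σ j j t = 1 := fun t => by simp [nikDensity]
    refine ⟨a (j + 1), b (j + 1), ν (j + 1), fun i t => ε (j + 1) * nikDensity σ (j + 1) i t,
      hs.good, hdj, nz_nikDensity h hd (by omega) hj, fun i hi => ?_,
      (ih (j := j + 1) (by omega)).congr_mul (NZ.const hε) fun i _ x _ => rfl⟩
    have hi' : j + 1 ≤ i ∧ i < j + 1 + (r + 1) := by
      have := List.mem_range'_1.1 (show i ∈ List.range' (j + 1) (r + 1) from hi)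
      omega
    have hn := nz_nikDensity h hd (k := i) (by omega) (r := r) (j := j + 1) (by omega)
    refine ⟨hn.const_mul hε, fun x hx => ?_⟩
    rw [hj1, one_mul, Good.cau_const_mul, ← nikSys_cauchyR hs hn.1 (hdj.subset_compl_right hx),
      nikDensity, if_pos (by omega)]

end Nikishin

/-- The real form of the type II approximation condition. -/
theorem IsTypeII.tendsto {σ : ℕ → SignedM} {m : ℕ} {n : ℕ → ℕ} {Q : ℝ[X]} {P : ℕ → ℝ[X]}
    (h : IsTypeII σ m n Q P) {k : ℕ} (hk : k ≤ m) :
    Tendsto (fun z => z ^ n k * (Q.eval z * (nikSys σ 0 k).cauchyR z - (P k).eval z)) atTop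
      (nhds 0) := by
  obtain ⟨C, R, hCR⟩ := h.2.2 k hk
  refine squeeze_zero_norm' (a := fun z => C / z) ?_ (tendsto_const_nhds.div_atTop tendsto_id)
  filter_upwards [eventually_ge_atTop R, eventually_gt_atTop 0] with z hzR hz
  have hzn : ‖(z : ℂ)‖ = z := by rw [Complex.norm_real, Real.norm_of_nonneg hz.le]
  have hpoly : ∀ p : ℝ[X], aeval (z : ℂ) p = ((p.eval z : ℝ) : ℂ) := fun p =>
    aeval_algebraMap_apply_eq_algebraMap_eval z p
  have h1 := hCR z (hzR.trans hzn.ge)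
  rw [SignedM.cauchy_ofReal, hpoly, hpoly, hzn, ← Complex.ofReal_mul, ← Complex.ofReal_sub,
    Complex.norm_real] at h1
  rw [norm_mul, Real.norm_of_nonneg (by positivity)]
  calc z ^ n k * ‖Q.eval z * (nikSys σ 0 k).cauchyR z - (P k).eval z‖
      ≤ z ^ n k * (C / z ^ (n k + 1)) := by gcongr
    _ = C / z := by rw [pow_succ]; field_simp

theorem exists_eq_C_mul_prod {N : ℕ} {Q : ℝ[X]} (hQ : Q ≠ 0) (hdeg : Q.degree ≤ (N : WithBot ℕ))
    {x : Fin N → ℝ} (hx : Function.Injective x) (hx0 : ∀ i, Q.eval (x i) = 0) :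
    ∃ c ≠ 0, Q = C c * ∏ i, (X - C (x i)) := by
  obtain ⟨r, hr⟩ : ∏ i, (X - C (x i)) ∣ Q := Finset.prod_dvd_of_coprime
    ((pairwise_coprime_X_sub_C hx).set_pairwise _) fun i _ => dvd_iff_isRoot.2 (hx0 i)
  have hr0 : r ≠ 0 := by
    rintro rfl
    exact hQ (by rw [hr, mul_zero])
  have hp : (∏ i, (X - C (x i))).natDegree = N := by
    rw [natDegree_prod_of_monic _ _ fun i _ => monic_X_sub_C _]; simp
  have hp0 : (∏ i, (X - C (x i))) ≠ 0 := (monic_prod_of_monic _ _ fun i _ => monic_X_sub_C _).ne_zero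
  have h1 := natDegree_le_of_degree_le hdeg
  rw [hr, natDegree_mul hp0 hr0, hp] at h1
  obtain ⟨c, rfl⟩ := natDegree_eq_zero.1 (show r.natDegree = 0 by omega)
  exact ⟨c, fun h => hr0 (by rw [h, C_0]), by rw [hr, mul_comm]⟩

/-- Corollary 2, second part: for the multi-index `n = (n, n+1, …, n+1)` the quadrature
coefficients `λ_{n,k,i} = P_{n,k}(x_i)/Q_n'(x_i)` are nonzero and have the same sign as
the measure `s_{0,k}` (whose sign is that of its total mass `∫ 1 ds_{0,k}`). -/
theorem stmt12
    (m : ℕ)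
    (σ : ℕ → SignedM) (Δ : ℕ → Set ℝ)
    (hσ : ∀ j ≤ m, IsM (σ j) (Δ j))
    (hdisj : ∀ j, j + 1 ≤ m → Δ j ∩ Δ (j + 1) = ∅)
    (n : ℕ) (nn : ℕ → ℕ) (hnn : ∀ j, nn j = if j = 0 then n else n + 1)
    (N : ℕ) (hN : N = ∑ j ∈ Finset.range (m + 1), nn j)
    (Q : Polynomial ℝ) (P : ℕ → Polynomial ℝ)
    (hQP : IsTypeII σ m nn Q P)
    (x : Fin N → ℝ) (hx : StrictMono x)
    (hxint : ∀ i, x i ∈ interior (Δ 0))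
    (hxzero : ∀ i, Polynomial.eval (x i) Q = 0)
    (hxsimple : ∀ i, Polynomial.eval (x i) (Polynomial.derivative Q) ≠ 0)
    (hxall : ∀ z : ℂ, aeval z Q = 0 → ∃ i, ((x i : ℝ) : ℂ) = z) :
    ∀ k ≤ m, ∀ i : Fin N,
      Polynomial.eval (x i) (P k) / Polynomial.eval (x i) (Polynomial.derivative Q) ≠ 0 ∧
      0 < (Polynomial.eval (x i) (P k) /
            Polynomial.eval (x i) (Polynomial.derivative Q)) *
          (nikSys σ 0 k).rintegral (fun _ => 1) := by
  intro k hk i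
  choose! ν ε a b hΔ hs using fun j hj => (hσ j hj).exists_hasSign
  have hd : ∀ j, j + 1 ≤ m → Disjoint (Icc (a j) (b j)) (Icc (a (j + 1)) (b (j + 1))) :=
    fun j hj => by
      rw [← hΔ j (by omega), ← hΔ (j + 1) hj]
      exact disjoint_iff_inter_eq_empty.2 (hdisj j hj)
  have hs0 := hs 0 m.zero_le
  have hN' : N = m * (n + 1) + n := by
    rw [hN, Finset.sum_range_succ']
    simp [hnn]
  rw [hΔ 0 m.zero_le, interior_Icc] at hxint
  have hnz : ∀ j < m + 1, NZ (nikDensity σ 0 j) (a 0) (b 0) := fun j hj =>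
    nz_nikDensity hs hd (Nat.le_of_lt_succ hj) (zero_add m)
  obtain ⟨lc, hlc, hQ⟩ := exists_eq_C_mul_prod hQP.1 (by rw [hN]; exact hQP.2.1) hx.injective hxzero
  set q : ℝ[X] := C lc * ∏ j ∈ Finset.univ.erase i, (X - C (x j)) with hq
  have hQq : Q = (X - C (x i)) * q := by
    rw [hQ, ← Finset.mul_prod_erase _ _ (Finset.mem_univ i), hq]
    ring
  have hQ' : (derivative Q).eval (x i) = q.eval (x i) := by
    rw [hQq, derivative_mul]
    simp
  have hpade : ∀ j < m + 1, (P j).eval (x i) =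
      ∫ t, q.eval t * (ε 0 * nikDensity σ 0 j t) ∂ν 0 ∧
      ∀ p : ℝ[X], p.degree < (nn j : WithBot ℕ) →
        ∫ t, q.eval t * ((t - x i) * (p.eval t * (ε 0 * nikDensity σ 0 j t))) ∂ν 0 = 0 :=
    fun j hj => by
      have hc := (hnz j hj).1
      refine hs0.good.eval_eq_integral_of_tendsto (by fun_prop) ?_
      refine (hQP.tendsto (Nat.le_of_lt_succ hj)).congr' ?_
      filter_upwards [eventually_gt_atTop (b 0)] with z hz
      rw [nikSys_cauchyR hs0 hc fun hm => hm.2.not_gt hz, Good.cau_const_mul, hQq]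
  have hk1 : k < m + 1 := Nat.lt_succ_of_le hk
  have hP : (P k).eval (x i) = ε 0 * ∫ t, q.eval t * nikDensity σ 0 k t ∂ν 0 := by
    rw [(hpade k hk1).1, ← integral_const_mul]
    simp only [mul_left_comm]
  have hweight := hs0.good.weight_pos (f := nikDensity σ 0) (d := nn) (m := m + 1) (k := k) (N := N)
    (S := (Finset.univ.erase i).image x) (q := q) (lc := lc) (ξ := x i)
    (fun j hj => (hnz j hj).1) hk1 (hxint i) hN.symm
    (fun c p hp hne Z hZ hz => by
      rw [hN']
      refine (nChain_nikDensity hs hd (zero_add m)).card_le_range hk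
        (Ioo_subset_Icc_self (hxint i)) (by simpa [hnn] using hp 0 m.succ_pos) (fun j hj => ?_)
        hne Z hZ hz
      have hj' := List.mem_range'_1.1 hj
      have := hp j (by omega)
      rwa [hnn, if_neg (by omega)] at this)
    hlc
    (fun y => by
      rw [hq, Finset.prod_image hx.injective.injOn]
      simp [eval_prod])
    (by
      rw [Finset.card_image_of_injective _ hx.injective, Finset.card_erase_of_mem
        (Finset.mem_univ i), Finset.card_univ, Fintype.card_fin]
      have := i.pos
      omega)
    (fun s hs => by
      obtain ⟨j, -, rfl⟩ := Finset.mem_image.1 hs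
      exact hxint j)
    (fun hmem => by
      obtain ⟨j, hj, hji⟩ := Finset.mem_image.1 hmem
      exact Finset.ne_of_mem_erase hj (hx.injective hji))
    ((hnz k hk1).2 _ (Ioo_subset_Icc_self (hxint i)))
    (fun j hj p hp => by
      have h1 := (hpade j hj).2 p hp
      simp only [mul_left_comm _ (ε 0)] at h1
      rw [integral_const_mul] at h1
      exact (mul_eq_zero.1 h1).resolve_left hs0.ne_zero)
  have hone : (nikSys σ 0 k).rintegral (fun _ => 1) = ε 0 * ∫ t, nikDensity σ 0 k t ∂ν 0 := by
    rw [nikSys_rintegral hs0 (hnz k hk1).1 continuousOn_const]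
    simp only [one_mul]
  have hmass : 0 < nikDensity σ 0 k (x i) * ∫ t, nikDensity σ 0 k t ∂ν 0 := by
    have hxi := Ioo_subset_Icc_self (hxint i)
    have hn := (hnz k hk1).const_mul ((hnz k hk1).2 _ hxi)
    have hpos : ∀ t ∈ Icc (a 0) (b 0), 0 < nikDensity σ 0 k (x i) * nikDensity σ 0 k t :=
      hn.sign.resolve_right fun h => (mul_self_nonneg _).not_gt (h _ hxi)
    rw [← integral_const_mul]
    exact hs0.good.integral_pos hn.1 (fun t ht => (hpos t ht).le) ∅ fun t ht h0 =>
      absurd h0 (hpos t ht).ne'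
  have hqi : q.eval (x i) ≠ 0 := hQ' ▸ hxsimple i
  have hpos : 0 < (P k).eval (x i) / (derivative Q).eval (x i) *
      (nikSys σ 0 k).rintegral (fun _ => 1) := by
    rw [hP, hQ', hone]
    have h1 := mul_pos hweight hmass
    set I := ∫ t, q.eval t * nikDensity σ 0 k t ∂ν 0
    set J := ∫ t, nikDensity σ 0 k t ∂ν 0
    have h2 : ε 0 * I / q.eval (x i) * (ε 0 * J) =
        (ε 0 / (q.eval (x i) * nikDensity σ 0 k (x i))) ^ 2 *
          (I * (nikDensity σ 0 k (x i) * q.eval (x i)) * (nikDensity σ 0 k (x i) * J)) := by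
      have := (hnz k hk1).2 _ (Ioo_subset_Icc_self (hxint i))
      field_simp
    rw [h2]
    have := hs0.ne_zero
    have := (hnz k hk1).2 _ (Ioo_subset_Icc_self (hxint i))
    positivity
  exact ⟨fun h0 => by simp [h0] at hpos, hpos⟩
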